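/- arXiv:1206.4584 — 2 statements merged into one kernel-verified Lean document; each statement's English description precedes it below -/
import Mathlib

section
/- Let β = 2 and b := 3n for each integer n ≥ 1, and for l ≤ n let K_l(n) denote the l-th cumulant of the Wigner delay time τ_W, defined from the moments μ_j(n) := E[τ_W^j] (which are finite for j ≤ n) by the standard moment–cumulant recursion μ_l(n) = ∑_{j=0}^{l−1} C(l−1, j) · K_{l−j}(n) · μ_j(n) with μ_0 = 1. Then for every fixed l ≥ 1, lim_{n→∞} n^{2l−2} · K_l(n) / (l−1)! = p_l, where (p_l)_{l≥1} is determined by p_1 = 1 and the recurrence (l+1)·p_{l+1} = 2(2l−1)·p_l + 2·∑_{i=0}^{l−1}(3i+1)(l−i)·p_{i+1}·p_{l−i}. -/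
open MeasureTheory Filter Finset

/-- The β-deformed Vandermonde interaction factor `∏_{j<k} |τ_k - τ_j|^β`. -/
noncomputable def vand (β : ℝ) {n : ℕ} (T : Fin n → ℝ) : ℝ :=
  ∏ j, ∏ k ∈ Finset.Ioi j, |T k - T j| ^ β

/-- The `j`-th moment `E[τ_W^j]` of the Wigner delay time for `β = 2`, `b = 3n`,
where the proper delay times have density proportional to
`∏_i τ_i^{-3n} e^{-n/τ_i} ∏_{i<k}|τ_k-τ_i|²` on `(0,∞)^n`. -/
noncomputable def wigMoment (n j : ℕ) : ℝ :=
  (∫ τ in Set.univ.pi (fun _ : Fin n => Set.Ioi (0 : ℝ)),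
      ((1 / (n : ℝ)) * ∑ i, τ i) ^ j *
        ((∏ i, τ i ^ (-(3 * (n : ℝ))) * Real.exp (-((n : ℝ) / τ i))) * vand 2 τ)) /
    ∫ τ in Set.univ.pi (fun _ : Fin n => Set.Ioi (0 : ℝ)),
      (∏ i, τ i ^ (-(3 * (n : ℝ))) * Real.exp (-((n : ℝ) / τ i))) * vand 2 τ

/-- The moments with the convention `μ_0 = 1`. -/
noncomputable def wigMu (n j : ℕ) : ℝ := if j = 0 then 1 else wigMoment n j

section PowerSeriesSqrt
open PowerSeries

/-- Coefficients of the square root, with constant term `r`, of the power series with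
coefficients `a`, where `u` is an inverse of `2 * r`. -/
noncomputable def sqrtCoeff {A : Type*} [CommRing A] (u r : A) (a : ℕ → A) : ℕ → A
  | 0 => r
  | 1 => u * a 1
  | k + 2 => u * (a (k + 2) - ∑ ij ∈ (antidiagonal k).attach,
      sqrtCoeff u r a (ij.1.1 + 1) * sqrtCoeff u r a (ij.1.2 + 1))
  decreasing_by
    all_goals
      have h := mem_antidiagonal.1 ij.2
      omega

theorem exists_sq_eq_of_constantCoeff {A : Type*} [CommRing A] (a : A⟦X⟧) (u r : A)
    (hu : 2 * r * u = 1) (ha : coeff 0 a = r ^ 2) :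
    ∃ R : A⟦X⟧, R ^ 2 = a ∧ coeff 0 R = r := by
  refine ⟨mk (sqrtCoeff u r fun k => coeff k a), ?_, by simp [sqrtCoeff]⟩
  ext k
  rw [pow_two, coeff_mul]
  simp only [coeff_mk]
  match k with
  | 0 => simp only [Nat.antidiagonal_zero, sum_singleton, sqrtCoeff, ha]; ring
  | 1 =>
    rw [Nat.sum_antidiagonal_succ, Nat.antidiagonal_zero, sum_singleton]
    simp only [sqrtCoeff, zero_add]
    linear_combination coeff 1 a * hu
  | k + 2 =>
    rw [Nat.sum_antidiagonal_succ, Nat.sum_antidiagonal_succ']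
    rw [sqrtCoeff, sqrtCoeff,
      sum_attach (antidiagonal k) (fun ij => sqrtCoeff u r (fun k => coeff k a) (ij.1 + 1) *
        sqrtCoeff u r (fun k => coeff k a) (ij.2 + 1))]
    simp only
    generalize ∑ ij ∈ antidiagonal k, sqrtCoeff u r (fun k => coeff k a) (ij.1 + 1) *
        sqrtCoeff u r (fun k => coeff k a) (ij.2 + 1) = S
    linear_combination (coeff (k+2) a - S) * hu

end PowerSeriesSqrt

section LimitingRecurrence
open PowerSeries

theorem eq_zero_of_derivative_eq_mul {E a : ℝ⟦X⟧} (h0 : constantCoeff E = 0)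
    (h : d⁄dX ℝ E = a * E) : E = 0 := by
  ext k
  induction k using Nat.strong_induction_on with
  | _ k ih =>
    match k with
    | 0 => simpa using h0
    | k + 1 =>
      have h1 := congrArg (coeff k) h
      rw [coeff_derivative, coeff_mul, sum_eq_zero] at h1
      · have : (k : ℝ) + 1 ≠ 0 := by positivity
        simpa [this] using h1
      · intro ij hij
        have := mem_antidiagonal.1 hij
        rw [ih ij.2 (by omega), map_zero, mul_zero]

variable {p : ℕ → ℝ}

theorem recurrence_generating_ode (hp1 : p 1 = 1)
    (hprec : ∀ l : ℕ, 1 ≤ l →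
      ((l : ℝ) + 1) * p (l + 1)
        = 2 * (2 * (l : ℝ) - 1) * p l
          + 2 * ∑ i ∈ Finset.range l,
              (3 * (i : ℝ) + 1) * ((l : ℝ) - (i : ℝ)) * p (i + 1) * p (l - i))
    {y q : ℝ⟦X⟧} (hy : y = mk fun l => p (l + 1)) (hq : q = d⁄dX ℝ (X * y)) :
    q = 1 + 4 * X * q - 2 * X * y + 2 * (X * ((3 * q - 2 * y) * q)) := by
  have hqc : ∀ k, coeff k q = ((k : ℝ) + 1) * p (k + 1) := by
    intro k
    rw [hq, coeff_derivative, coeff_succ_X_mul, hy, coeff_mk, mul_comm]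
  have hyc : ∀ k, coeff k y = p (k + 1) := by
    intro k
    rw [hy, coeff_mk]
  have e : (1 + 4 * X * q - 2 * X * y + 2 * (X * ((3 * q - 2 * y) * q)) : ℝ⟦X⟧)
      = 1 + X * (C (4 : ℝ) * q - C (2 : ℝ) * y +
        C (2 : ℝ) * ((C (3 : ℝ) * q - C (2 : ℝ) * y) * q)) := by
    have h2 : (C (2 : ℝ) : ℝ⟦X⟧) = 2 := map_ofNat _ 2
    have h3 : (C (3 : ℝ) : ℝ⟦X⟧) = 3 := map_ofNat _ 3
    have h4 : (C (4 : ℝ) : ℝ⟦X⟧) = 4 := map_ofNat _ 4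
    rw [h2, h3, h4]; ring
  rw [e]
  ext k
  match k with
  | 0 => rw [hqc]; simp [hp1]
  | k + 1 =>
    rw [hqc, map_add, coeff_succ_X_mul, map_add, map_sub, coeff_C_mul, coeff_C_mul, coeff_C_mul,
      coeff_mul, hqc, hyc, coeff_one, if_neg (Nat.succ_ne_zero k), hprec (k + 1) (by omega),
      Nat.sum_antidiagonal_eq_sum_range_succ_mk]
    have : ∀ i ∈ range (k + 1), coeff i (C (3 : ℝ) * q - C (2 : ℝ) * y) * coeff (k - i) q
        = (3 * (i : ℝ) + 1) * (((k + 1 : ℕ) : ℝ) - (i : ℝ)) * p (i + 1) * p (k + 1 - i) := by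
      intro i hi
      have hi' : i ≤ k := by simpa [Nat.lt_succ_iff] using hi
      rw [map_sub, coeff_C_mul, coeff_C_mul, hqc, hyc, hqc, Nat.cast_sub hi',
        show k - i + 1 = k + 1 - i by omega]
      push_cast
      ring
    rw [sum_congr rfl this]
    push_cast
    ring

theorem ode_algebraic_relation {y q : ℝ⟦X⟧} (hq : q = d⁄dX ℝ (X * y))
    (hq0 : constantCoeff q = 1)
    (hode : q = 1 + 4 * X * q - 2 * X * y + 2 * (X * ((3 * q - 2 * y) * q))) :
    4 * X * q ^ 2 * (q + 1) ^ 2 = (q - 1) * (3 * q + 1) := by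
  have hT : d⁄dX ℝ (X * y) = q := hq.symm
  have hd := congrArg (d⁄dX ℝ) hode
  set T : ℝ⟦X⟧ := X * y with hTdef
  have hode' : q = 1 + 4 * (X * q) - 2 * T + 6 * (X * (q * q)) - 4 * (T * q) := by
    rw [hTdef]; linear_combination hode
  set q' : ℝ⟦X⟧ := d⁄dX ℝ q with hq'
  have n2 : d⁄dX ℝ (2 : ℝ⟦X⟧) = 0 := by simpa using (d⁄dX ℝ).map_natCast 2
  have n3 : d⁄dX ℝ (3 : ℝ⟦X⟧) = 0 := by simpa using (d⁄dX ℝ).map_natCast 3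
  have n4 : d⁄dX ℝ (4 : ℝ⟦X⟧) = 0 := by simpa using (d⁄dX ℝ).map_natCast 4
  have n6 : d⁄dX ℝ (6 : ℝ⟦X⟧) = 0 := by simpa using (d⁄dX ℝ).map_natCast 6
  have n1 : d⁄dX ℝ (1 : ℝ⟦X⟧) = 0 := by simp
  have hd : q' = 4 * (q + X * q') - 2 * q + 6 * (q * q + X * (2 * q * q'))
      - 4 * (T * q' + q * q) := by
    have := congrArg (d⁄dX ℝ) hode'
    simp only [map_add, map_sub, Derivation.leibniz, smul_eq_mul, n1, n2, n4, n6, hT,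
      derivative_X, ← hq'] at this
    linear_combination this
  have hDq : q' * (3 - 4 * X * (1 + 3 * q + 3 * q ^ 2)) = 2 * q * (1 + q) * (1 + 2 * q) := by
    have h1 : (2 : ℝ⟦X⟧) * (q' * (3 - 4 * X * (1 + 3 * q + 3 * q ^ 2)))
        = 2 * (2 * q * (1 + q) * (1 + 2 * q)) := by
      linear_combination (2 + 4 * q) * hd - 4 * q' * hode'
    have h2 : (2 : ℝ⟦X⟧) ≠ 0 := fun h => by
      simpa [map_ofNat] using congrArg constantCoeff h
    exact mul_left_cancel₀ h2 h1
  set D : ℝ⟦X⟧ := 3 - 4 * X * (1 + 3 * q + 3 * q ^ 2) with hD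
  have hD0 : constantCoeff D ≠ 0 := by
    rw [hD]; simp [map_ofNat]
  set E : ℝ⟦X⟧ := 4 * X * q ^ 2 * (q + 1) ^ 2 - (q - 1) * (3 * q + 1) with hE
  have hE' : d⁄dX ℝ E = 4 * q ^ 2 * (q + 1) ^ 2 +
      q' * (8 * X * q * (q + 1) * (2 * q + 1) - 6 * q + 2) := by
    rw [hE]
    simp only [map_add, map_sub, Derivation.leibniz, smul_eq_mul, n1, n3, n4, pow_two,
      derivative_X, ← hq']
    ring
  have hDE : D * d⁄dX ℝ E = 4 * q * (q + 1) * E := by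
    rw [hE', hE]
    linear_combination (8 * X * q * (q + 1) * (2 * q + 1) - 6 * q + 2) * hDq
      + 4 * q ^ 2 * (q + 1) ^ 2 * hD
  have hE0 : E = 0 := by
    apply eq_zero_of_derivative_eq_mul (a := D⁻¹ * (4 * q * (q + 1)))
    · rw [hE]; simp [hq0]
    · rw [mul_assoc, ← hDE, ← mul_assoc, PowerSeries.inv_mul_cancel _ hD0, one_mul]
  linear_combination hE0

/-- The genus-zero loop equations are solved by the algebraic function attached to `p`. -/
theorem exists_planar_solution (hp1 : p 1 = 1)
    (hprec : ∀ l : ℕ, 1 ≤ l →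
      ((l : ℝ) + 1) * p (l + 1)
        = 2 * (2 * (l : ℝ) - 1) * p l
          + 2 * ∑ i ∈ Finset.range l,
              (3 * (i : ℝ) + 1) * ((l : ℝ) - (i : ℝ)) * p (i + 1) * p (l - i)) :
    ∃ c : ℕ → ℝ⟦X⟧, (c 0 = mk fun l => p (l + 1)) ∧ c 0 = 1 + X * c 1 ∧
      ∀ k, c (k + 1) = c k + ∑ ab ∈ antidiagonal k, c ab.1 * c ab.2 + X * c (k + 2) := by
  obtain ⟨y, hy⟩ : ∃ y : ℝ⟦X⟧, y = mk fun l => p (l + 1) := ⟨_, rfl⟩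
  obtain ⟨q, hq⟩ : ∃ q : ℝ⟦X⟧, q = d⁄dX ℝ (X * y) := ⟨_, rfl⟩
  have hode := recurrence_generating_ode hp1 hprec hy hq
  have hq0 : constantCoeff q = 1 := by rw [hode]; simp
  have hrel := ode_algebraic_relation hq hq0 hode
  obtain ⟨w, hw⟩ : ∃ w : ℝ⟦X⟧, 2 * q * (q + 1) * w = 1 :=
    ⟨_, PowerSeries.mul_inv_cancel _ (by simp [map_ofNat, hq0])⟩
  obtain ⟨v, hv⟩ : ∃ v : ℝ⟦X⟧, (3 * q + 1) * v = 1 :=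
    ⟨_, PowerSeries.mul_inv_cancel _ (by simp [map_ofNat, hq0]; norm_num)⟩
  obtain ⟨s, hs⟩ : ∃ s : ℝ⟦X⟧, (2 + 4 * q) * s = 1 :=
    ⟨_, PowerSeries.mul_inv_cancel _ (by simp [map_ofNat, hq0]; norm_num)⟩
  obtain ⟨z, hz⟩ : ∃ z : ℝ⟦X⟧, z = (q - 1) * w := ⟨_, rfl⟩
  obtain ⟨r, hr⟩ : ∃ r : ℝ⟦X⟧, r = (3 * q + 1) * w := ⟨_, rfl⟩
  have hzr : z * r = X := by
    rw [hz, hr]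
    linear_combination (-w^2) * hrel + X * (2 * q * (q + 1) * w + 1) * hw
  have hT : (2 + 4 * q) * (X * y) = 1 - q + 4 * X * q + 6 * X * q ^ 2 := by
    linear_combination hode
  set T : ℝ⟦X⟧ := X * y with hTdef
  have h1 : r - r ^ 2 + z ^ 2 - 3 * z = 0 := by
    rw [hz, hr]; linear_combination (-4 * w) * hw
  have h2 : r ^ 2 - 3 * z ^ 2 + 12 * z = 1 + 2 * X + 4 * T := by
    have : (2 + 4 * q) * (r ^ 2 - 3 * z ^ 2 + 12 * z) = (2 + 4 * q) * (1 + 2 * X + 4 * T) := by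
      rw [← hzr] at hT ⊢
      rw [hz, hr] at hT ⊢
      linear_combination ((-36 * q ^ 2 + 36 * q + 24) * w + 6) * hw - 4 * hT
    calc _ = s * ((2 + 4 * q) * (r ^ 2 - 3 * z ^ 2 + 12 * z)) := by
          linear_combination (-(r ^ 2 - 3 * z ^ 2 + 12 * z)) * hs
      _ = _ := by rw [this]; linear_combination (1 + 2 * X + 4 * T) * hs
  obtain ⟨R, hR, hR0⟩ := exists_sq_eq_of_constantCoeff
    (C (r ^ 2) + C (2 * z - 6) * X + X ^ 2 : ℝ⟦X⟧⟦X⟧) (v * q * (q + 1)) r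
    (by rw [hr]; linear_combination (2 * q * (q + 1) * w) * hv + hw) (by simp)
  obtain ⟨V, hV⟩ : ∃ V : ℝ⟦X⟧⟦X⟧, V = (C z - X) * R := ⟨_, rfl⟩
  have hV2 : V ^ 2 = (X ^ 2 - X + C X) ^ 2 - 4 * X ^ 2 * (X - C T) := by
    have e1 : z ^ 2 * r ^ 2 = X ^ 2 := by rw [← hzr]; ring
    have e2 : -2 * z * r ^ 2 + (2 * z - 6) * z ^ 2 = -2 * X := by
      linear_combination 2 * z * h1 - 2 * hzr
    have e3 : r ^ 2 - 2 * z * (2 * z - 6) + z ^ 2 = 1 + 2 * X + 4 * T := by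
      linear_combination h2
    have e1' := congrArg (C : ℝ⟦X⟧ → ℝ⟦X⟧⟦X⟧) e1
    have e2' := congrArg (C : ℝ⟦X⟧ → ℝ⟦X⟧⟦X⟧) e2
    have e3' := congrArg (C : ℝ⟦X⟧ → ℝ⟦X⟧⟦X⟧) e3
    simp only [map_add, map_sub, map_mul, map_pow, map_neg, map_ofNat, map_one] at e1' e2' e3'
    rw [hV, mul_pow, hR]
    simp only [map_sub, map_mul, map_pow, map_ofNat]
    linear_combination e1' + X * e2' + X ^ 2 * e3'
  have hV0 : coeff 0 V = X := by
    rw [hV]; simpa [coeff_zero_eq_constantCoeff, ← hR0] using hzr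
  have hX : (X : ℝ⟦X⟧) ≠ 0 := X_ne_zero
  have h2ne : (2 : ℝ⟦X⟧) ≠ 0 := fun h => by
    simpa [map_ofNat] using congrArg constantCoeff h
  obtain ⟨V₁, hV₁⟩ : ∃ V₁ : ℝ⟦X⟧⟦X⟧, V = X * V₁ + C X := by
    have := eq_X_mul_shift_add_const V
    rw [← coeff_zero_eq_constantCoeff_apply, hV0] at this
    exact ⟨_, this⟩
  have hXX : (X : ℝ⟦X⟧⟦X⟧) ≠ 0 := X_ne_zero
  have hV₁2 : 2 * (C X * V₁) + X * V₁ ^ 2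
      = 2 * (C X * (X - 1)) + X * ((X - 1) ^ 2 - 4 * (X - C T)) := by
    apply mul_left_cancel₀ hXX
    rw [hV₁] at hV2
    linear_combination hV2
  have hV10 : coeff 0 V₁ = -1 := by
    have := congrArg (constantCoeff (R := ℝ⟦X⟧)) hV₁2
    simp only [map_add, map_sub, map_mul, map_pow, map_ofNat, map_one, constantCoeff_C,
      constantCoeff_X, zero_mul, add_zero, zero_sub] at this
    rw [coeff_zero_eq_constantCoeff_apply]
    exact mul_left_cancel₀ hX (mul_left_cancel₀ h2ne this)
  obtain ⟨V₂, hV₂⟩ : ∃ V₂ : ℝ⟦X⟧⟦X⟧, V₁ = X * V₂ + C (-1) := by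
    have := eq_X_mul_shift_add_const V₁
    rw [← coeff_zero_eq_constantCoeff_apply, hV10] at this
    exact ⟨_, this⟩
  obtain ⟨U, hU⟩ : ∃ U : ℝ⟦X⟧⟦X⟧, V₂ = 1 + 2 * U := by
    refine ⟨C (C (1 / 2)) * (V₂ - 1), ?_⟩
    have : (2 : ℝ⟦X⟧⟦X⟧) * C (C (1 / 2)) = 1 := by
      rw [← map_ofNat (C : ℝ⟦X⟧ →+* ℝ⟦X⟧⟦X⟧) 2, ← map_ofNat (C : ℝ →+* ℝ⟦X⟧) 2, ← map_mul,
        ← map_mul]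
      norm_num
    linear_combination (1 - V₂) * this
  have hloop : C X * U - X * U + X * (X * U) + X * (X * (U * U)) = C T - X := by
    have h4 : (4 : ℝ⟦X⟧⟦X⟧) * X ≠ 0 := mul_ne_zero (fun h => by
      simpa [map_ofNat] using congrArg (constantCoeff ∘ constantCoeff) h) hXX
    apply mul_left_cancel₀ h4
    rw [hV₂, hU, map_neg, map_one] at hV₁2
    linear_combination hV₁2
  refine ⟨fun k => coeff k U, ?_, ?_, fun k => ?_⟩
  · have := congrArg (coeff 0) hloop
    simp only [map_add, map_sub, coeff_C_mul, coeff_zero_X_mul, coeff_zero_C, coeff_zero_X,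
      sub_zero,
      add_zero] at this
    exact (mul_left_cancel₀ hX this).trans hy
  · have := congrArg (coeff 1) hloop
    simp only [map_add, map_sub, coeff_C_mul, coeff_succ_X_mul (n := 0), coeff_zero_X_mul,
      coeff_one_X, add_zero] at this
    rw [coeff_C, if_neg one_ne_zero] at this
    linear_combination -this
  · have := congrArg (coeff (k + 2)) hloop
    simp only [map_add, map_sub, coeff_C_mul, coeff_succ_X_mul, coeff_C,
      coeff_X] at this
    rw [if_neg (by omega), if_neg (by omega), coeff_mul] at this
    linear_combination -this

end LimitingRecurrence

section Uniqueness
open PowerSeries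

theorem planar_solution_unique {c d : ℕ → ℝ⟦X⟧}
    (hc0 : c 0 = 1 + X * c 1)
    (hc : ∀ k, c (k + 1) = c k + ∑ ab ∈ antidiagonal k, c ab.1 * c ab.2 + X * c (k + 2))
    (hd0 : d 0 = 1 + X * d 1)
    (hd : ∀ k, d (k + 1) = d k + ∑ ab ∈ antidiagonal k, d ab.1 * d ab.2 + X * d (k + 2)) :
    c = d := by
  suffices h : ∀ m k, coeff m (c k) = coeff m (d k) from
    funext fun k => PowerSeries.ext fun m => h m k
  intro m
  induction m using Nat.strong_induction_on with
  | _ m ihm =>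
    have hX : ∀ k, coeff m (X * c k) = coeff m (X * d k) := by
      intro k
      cases m with
      | zero => simp
      | succ m => rw [coeff_succ_X_mul, coeff_succ_X_mul, ihm m (Nat.lt_succ_self m)]
    intro k
    induction k using Nat.strong_induction_on with
    | _ k ihk =>
      cases k with
      | zero => rw [hc0, hd0, map_add, map_add, hX]
      | succ k =>
        have hle : ∀ m' ≤ m, ∀ k' ≤ k, coeff m' (c k') = coeff m' (d k') := by
          intro m' hm' k' hk'
          rcases hm'.lt_or_eq with h | rfl
          · exact ihm m' h k'
          · exact ihk k' (Nat.lt_succ_of_le hk')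
        rw [hc, hd, map_add, map_add, map_add, map_add, hX, hle m le_rfl k le_rfl, map_sum, map_sum]
        congr 2
        refine sum_congr rfl fun ab hab => ?_
        have hab' := mem_antidiagonal.1 hab
        rw [coeff_mul, coeff_mul]
        refine sum_congr rfl fun ij hij => ?_
        have hij' := mem_antidiagonal.1 hij
        rw [hle ij.1 (by omega) ab.1 (by omega), hle ij.2 (by omega) ab.2 (by omega)]

end Uniqueness

section Asymptotics

/-- `u` converges up to an error of order `e`. -/
def ConvergesModulo (e u : ℕ → ℝ) : Prop :=
  ∃ b : ℕ → ℝ, b =O[atTop] e ∧ ∃ v, Tendsto (fun n => u n - b n) atTop (nhds v)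

namespace ConvergesModulo
variable {e u v : ℕ → ℝ}

theorem of_tendsto {x : ℝ} (h : Tendsto u atTop (nhds x)) : ConvergesModulo e u :=
  ⟨fun _ => 0, Asymptotics.isBigO_zero _ _, x, by simpa using h⟩

theorem of_isBigO (h : u =O[atTop] e) : ConvergesModulo e u :=
  ⟨u, h, 0, by simp⟩

theorem add (hu : ConvergesModulo e u) (hv : ConvergesModulo e v) :
    ConvergesModulo e (fun n => u n + v n) := by
  obtain ⟨b, hb, x, hx⟩ := hu
  obtain ⟨c, hc, y, hy⟩ := hv
  exact ⟨_, hb.add hc, x + y, (hx.add hy).congr fun n => by ring⟩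

theorem const_mul (c : ℝ) (hu : ConvergesModulo e u) : ConvergesModulo e (fun n => c * u n) := by
  obtain ⟨b, hb, x, hx⟩ := hu
  exact ⟨_, hb.const_mul_left c, c * x, (hx.const_mul c).congr fun n => by ring⟩

theorem sum {ι : Type*} (s : Finset ι) {u : ι → ℕ → ℝ} (hu : ∀ i ∈ s, ConvergesModulo e (u i)) :
    ConvergesModulo e (fun n => ∑ i ∈ s, u i n) := by
  choose! b hb x hx using hu
  have hsum := Asymptotics.IsBigO.sum hb
  rw [show ∑ i ∈ s, b i = fun n => ∑ i ∈ s, b i n from funext fun n => sum_apply n s b] at hsum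
  exact ⟨fun n => ∑ i ∈ s, b i n, hsum, ∑ i ∈ s, x i,
    (tendsto_finsetSum s hx).congr fun n => by rw [sum_sub_distrib]⟩

theorem congr' (hu : ConvergesModulo e u) (h : u =ᶠ[atTop] v) : ConvergesModulo e v := by
  obtain ⟨b, hb, x, hx⟩ := hu
  exact ⟨b, hb, x, hx.congr' (h.mono fun n hn => by rw [hn])⟩

end ConvergesModulo

theorem exists_tendsto_of_convergesModulo {ι : Type*} (S : Finset ι) (g : ι → ℕ → ℝ) {ε : ℕ → ℝ}
    (hε : Tendsto ε atTop (nhds 0))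
    (h : ∀ s ∈ S, ConvergesModulo (fun n => ε n * ∑ s ∈ S, |g s n|) (g s)) :
    ∀ s ∈ S, ∃ v, Tendsto (g s) atTop (nhds v) := by
  choose! b hb x hx using h
  set T : ℕ → ℝ := fun n => ∑ s ∈ S, |g s n| with hT
  have hT0 : ∀ n, 0 ≤ T n := fun n => sum_nonneg fun _ _ => abs_nonneg _
  obtain ⟨C, hC⟩ := (Asymptotics.IsBigO.sum fun s hs => (hb s hs).norm_left).bound
  have hlim := (tendsto_finsetSum S fun s hs => (hx s hs).abs)
  set L := ∑ s ∈ S, |x s|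
  have h1 : ∀ᶠ n in atTop, ∑ s ∈ S, |g s n - b s n| < L + 1 :=
    hlim.eventually (gt_mem_nhds (lt_add_one L))
  have h2 : ∀ᶠ n in atTop, |C * ε n| < 1 / 2 := by
    have := (hε.const_mul C).abs
    rw [mul_zero, abs_zero] at this
    exact this.eventually (gt_mem_nhds (by norm_num))
  have hbd : ∀ᶠ n in atTop, T n ≤ 2 * (L + 1) := by
    filter_upwards [h1, h2, hC] with n hn1 hn2 hn3
    have e1 : T n ≤ ∑ s ∈ S, |g s n - b s n| + ∑ s ∈ S, |b s n| := by
      rw [← sum_add_distrib]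
      refine sum_le_sum fun s _ => ?_
      calc |g s n| = |(g s n - b s n) + b s n| := by rw [sub_add_cancel]
        _ ≤ _ := abs_add_le _ _
    have e2 : ∑ s ∈ S, |b s n| ≤ |C * ε n| * T n := by
      calc ∑ s ∈ S, |b s n| ≤ abs (∑ s ∈ S, |b s n|) := le_abs_self _
        _ ≤ C * |ε n * T n| := by simpa [Real.norm_eq_abs] using hn3
        _ ≤ |C| * |ε n * T n| := by gcongr; exact le_abs_self C
        _ = |C * ε n| * T n := by rw [abs_mul, abs_mul, abs_of_nonneg (hT0 n)]; ring
    nlinarith [hT0 n]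
  have hzero : Tendsto (fun n => ε n * T n) atTop (nhds 0) := by
    refine hε.zero_mul_isBoundedUnder_le ⟨2 * (L + 1), ?_⟩
    rw [eventually_map]
    filter_upwards [hbd] with n hn
    simpa [Real.norm_eq_abs, abs_of_nonneg (hT0 n)] using hn
  intro s hs
  refine ⟨x s + 0, ((hx s hs).add ((hb s hs).trans_tendsto hzero)).congr fun n => by ring⟩

/-- The weight of a monomial in the sources, the `j`-th source being of weight `j + 1`. -/
noncomputable abbrev sourceWeight : (ℕ →₀ ℕ) →+ ℕ := Finsupp.weight fun j : ℕ => j + 1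

theorem sourceWeight_sub_single {M : ℕ →₀ ℕ} {j : ℕ} (hj : j ∈ M.support) :
    sourceWeight (M - Finsupp.single j 1) + (j + 1) = sourceWeight M := by
  have h : M - Finsupp.single j 1 + Finsupp.single j 1 = M :=
    tsub_add_cancel_of_le (Finsupp.single_le_iff.2
      (Nat.one_le_iff_ne_zero.2 (Finsupp.mem_support_iff.1 hj)))
  conv_rhs => rw [← h, map_add]
  simp [Finsupp.weight_single]

theorem finite_setOf_sourceWeight_le (w : ℕ) : {M : ℕ →₀ ℕ | sourceWeight M ≤ w}.Finite := by
  refine (Set.finite_Iic (∑ j ∈ range w, Finsupp.single j w)).subset fun M hM j => ?_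
  have hM' : sourceWeight M ≤ w := hM
  rw [Finsupp.finsetSum_apply]
  by_cases hj : M j = 0
  · simp [hj]
  · have h1 : j + 1 ≤ sourceWeight M := Finsupp.le_weight_of_ne_zero' (fun j : ℕ => j + 1) hj
    have h2 : M j ≤ sourceWeight M :=
      Finsupp.le_weight (fun j : ℕ => j + 1) (Nat.succ_ne_zero j) M
    have hjw : j ∈ range w := mem_range.2 (by omega)
    rw [sum_eq_single j (fun i _ hij => by simp [hij]) (fun h => absurd hjw h),
      Finsupp.single_eq_same]
    omega

/-- The loop equations, at size `n` and up to total weight `n`, for the coefficients `g k M` of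
the derivatives of the free energy. -/
structure LoopEquations (n : ℕ) (g : ℕ → (ℕ →₀ ℕ) → ℝ) : Prop where
  zero : ∀ M, 1 + sourceWeight M ≤ n →
    g 0 M = (if M = 0 then 1 else 0) +
      ∑ j ∈ M.support, ((j : ℝ) + 1) * g (j + 1) (M - Finsupp.single j 1)
  succ : ∀ k M, k + 2 + sourceWeight M ≤ n →
    g (k + 1) M = g k M +
      ∑ ab ∈ antidiagonal k, (∑ AB ∈ antidiagonal M, g ab.1 AB.1 * g ab.2 AB.2 +
        ((n : ℝ) ^ 2)⁻¹ * (((M ab.1 : ℝ) + 1) * g ab.2 (M + Finsupp.single ab.1 1))) +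
      ∑ j ∈ M.support, ((j : ℝ) + 1) * g (k + 1 + j + 1) (M - Finsupp.single j 1)

theorem tendsto_inv_sq_atTop : Tendsto (fun n : ℕ => ((n : ℝ) ^ 2)⁻¹) atTop (nhds 0) :=
  ((tendsto_pow_atTop two_ne_zero).comp tendsto_natCast_atTop_atTop).inv_tendsto_atTop

theorem exists_tendsto_of_loopEquations {g : ℕ → ℕ → (ℕ →₀ ℕ) → ℝ}
    (hg : ∀ n, 1 ≤ n → LoopEquations n (g n)) (k : ℕ) (M : ℕ →₀ ℕ) :
    ∃ v, Tendsto (fun n => g n k M) atTop (nhds v) := by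
  suffices H : ∀ w k M, k + 1 + sourceWeight M = w →
      ∃ v, Tendsto (fun n => g n k M) atTop (nhds v) from H _ k M rfl
  intro w
  induction w using Nat.strong_induction_on with
  | _ w ih =>
    have hfin : Set.Finite {s : ℕ × (ℕ →₀ ℕ) | s.1 + 1 + sourceWeight s.2 = w} := by
      refine ((Set.finite_Iic w).prod (finite_setOf_sourceWeight_le w)).subset ?_
      rintro ⟨a, A⟩ h
      have h' : a + 1 + sourceWeight A = w := h
      exact ⟨show a ≤ w by omega, show sourceWeight A ≤ w by omega⟩
    set S := hfin.toFinset with hS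
    have hmem : ∀ k M, (k, M) ∈ S ↔ k + 1 + sourceWeight M = w := by
      intro k M; simp [hS]
    set e : ℕ → ℝ := fun n => ((n : ℝ) ^ 2)⁻¹ * ∑ s ∈ S, |g n s.1 s.2| with he
    have key : ∀ m k M, sourceWeight M = m → k + 1 + sourceWeight M = w →
        ConvergesModulo e (fun n => g n k M) := by
      intro m
      induction m using Nat.strong_induction_on with
      | _ m ihm =>
        intro k M hm hw
        have hjoin : ConvergesModulo e (fun n => ∑ j ∈ M.support,
            ((j : ℝ) + 1) * g n (k + j + 1) (M - Finsupp.single j 1)) := by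
          refine ConvergesModulo.sum _ fun j hj => ConvergesModulo.const_mul _ ?_
          have := sourceWeight_sub_single hj
          exact ihm _ (by omega) _ _ rfl (by omega)
        cases k with
        | zero =>
          refine ((ConvergesModulo.of_tendsto (tendsto_const_nhds
            (x := if M = 0 then (1 : ℝ) else 0))).add hjoin).congr' ?_
          filter_upwards [eventually_ge_atTop (w + 1)] with n hn
          rw [(hg n (by omega)).zero M (by omega)]
          simp only [zero_add]
        | succ k =>
          have hcut : ConvergesModulo e (fun n => ∑ ab ∈ antidiagonal k,
              (∑ AB ∈ antidiagonal M, g n ab.1 AB.1 * g n ab.2 AB.2 +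
                ((n : ℝ) ^ 2)⁻¹ * (((M ab.1 : ℝ) + 1) *
                  g n ab.2 (M + Finsupp.single ab.1 1)))) := by
            refine ConvergesModulo.sum _ fun ab hab => ConvergesModulo.add
              (ConvergesModulo.sum _ fun AB hAB => ?_) (ConvergesModulo.of_isBigO ?_)
            · have h1 := mem_antidiagonal.1 hab
              have h2 := congrArg sourceWeight (mem_antidiagonal.1 hAB)
              rw [map_add] at h2
              obtain ⟨x, hx⟩ := ih (ab.1 + 1 + sourceWeight AB.1) (by omega) _ _ rfl
              obtain ⟨y, hy⟩ := ih (ab.2 + 1 + sourceWeight AB.2) (by omega) _ _ rfl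
              exact ConvergesModulo.of_tendsto (hx.mul hy)
            · have h1 := mem_antidiagonal.1 hab
              refine Asymptotics.IsBigO.mul (Asymptotics.isBigO_refl _ _)
                (Asymptotics.IsBigO.const_mul_left (Asymptotics.IsBigO.of_bound 1
                  (Eventually.of_forall fun n => ?_)) _)
              have hs : (ab.2, M + Finsupp.single ab.1 1) ∈ S := by
                rw [hmem, map_add]
                simp only [Finsupp.weight_single, one_smul]
                omega
              rw [one_mul, Real.norm_eq_abs, Real.norm_eq_abs]
              exact (single_le_sum (f := fun s : ℕ × (ℕ →₀ ℕ) => |g n s.1 s.2|)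
                (fun _ _ => abs_nonneg _) hs).trans (le_abs_self _)
          obtain ⟨x, hx⟩ := ih (k + 1 + sourceWeight M) (by omega) k M rfl
          refine (((ConvergesModulo.of_tendsto hx).add hcut).add hjoin).congr' ?_
          filter_upwards [eventually_ge_atTop (w + 1)] with n hn
          rw [(hg n (by omega)).succ k M (by omega)]
    intro k M hw
    exact exists_tendsto_of_convergesModulo S (fun s n => g n s.1 s.2) tendsto_inv_sq_atTop
      (fun s hs => key _ s.1 s.2 rfl ((hmem _ _).1 hs)) (k, M) ((hmem _ _).2 hw)

end Asymptotics

section PlanarLimit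
open PowerSeries

theorem planar_limit_of_loopEquations {g : ℕ → ℕ → (ℕ →₀ ℕ) → ℝ}
    (hg : ∀ n, 1 ≤ n → LoopEquations n (g n)) :
    ∃ v : ℕ → (ℕ →₀ ℕ) → ℝ, (∀ k M, Tendsto (fun n => g n k M) atTop (nhds (v k M))) ∧
      (∀ M, v 0 M = (if M = 0 then 1 else 0) +
        ∑ j ∈ M.support, ((j : ℝ) + 1) * v (j + 1) (M - Finsupp.single j 1)) ∧
      ∀ k M, v (k + 1) M = v k M +
        ∑ ab ∈ antidiagonal k, ∑ AB ∈ antidiagonal M, v ab.1 AB.1 * v ab.2 AB.2 +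
        ∑ j ∈ M.support, ((j : ℝ) + 1) * v (k + 1 + j + 1) (M - Finsupp.single j 1) := by
  choose v hv using exists_tendsto_of_loopEquations hg
  refine ⟨v, hv, fun M => ?_, fun k M => ?_⟩
  · refine tendsto_nhds_unique (hv 0 M) (Tendsto.congr' ?_ (tendsto_const_nhds.add
      (tendsto_finsetSum M.support fun j _ =>
        (hv (j + 1) (M - Finsupp.single j 1)).const_mul ((j : ℝ) + 1))))
    filter_upwards [eventually_ge_atTop (1 + sourceWeight M)] with n hn
    rw [(hg n (by omega)).zero M hn]
  · have hcut := tendsto_finsetSum (antidiagonal k) fun ab _ =>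
      (tendsto_finsetSum (antidiagonal M) fun AB _ => (hv ab.1 AB.1).mul (hv ab.2 AB.2)).add
        (tendsto_inv_sq_atTop.mul
          ((hv ab.2 (M + Finsupp.single ab.1 1)).const_mul ((M ab.1 : ℝ) + 1)))
    simp only [zero_mul, add_zero] at hcut
    refine tendsto_nhds_unique (hv (k + 1) M) (Tendsto.congr' ?_ (((hv k M).add hcut).add
      (tendsto_finsetSum M.support fun j _ =>
        (hv (k + 1 + j + 1) (M - Finsupp.single j 1)).const_mul ((j : ℝ) + 1))))
    filter_upwards [eventually_ge_atTop (k + 2 + sourceWeight M)] with n hn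
    rw [(hg n (by omega)).succ k M hn]

theorem sum_support_single_zero (m : ℕ) (f : ℕ → (ℕ →₀ ℕ) → ℝ) :
    ∑ j ∈ (Finsupp.single 0 m : ℕ →₀ ℕ).support,
      ((j : ℝ) + 1) * f (j + 1) (Finsupp.single 0 m - Finsupp.single j 1) =
    coeff m (X * PowerSeries.mk fun i => f 1 (Finsupp.single 0 i)) := by
  cases m with
  | zero => simp
  | succ m =>
    rw [Finsupp.support_single _ (Nat.succ_ne_zero m), sum_singleton, coeff_succ_X_mul, coeff_mk,
      ← Finsupp.single_tsub]
    simp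

theorem tendsto_of_loopEquations {p : ℕ → ℝ} (hp1 : p 1 = 1)
    (hprec : ∀ l : ℕ, 1 ≤ l →
      ((l : ℝ) + 1) * p (l + 1)
        = 2 * (2 * (l : ℝ) - 1) * p l
          + 2 * ∑ i ∈ Finset.range l,
              (3 * (i : ℝ) + 1) * ((l : ℝ) - (i : ℝ)) * p (i + 1) * p (l - i))
    {g : ℕ → ℕ → (ℕ →₀ ℕ) → ℝ} (hg : ∀ n, 1 ≤ n → LoopEquations n (g n)) (m : ℕ) :
    Tendsto (fun n => g n 0 (Finsupp.single 0 m)) atTop (nhds (p (m + 1))) := by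
  obtain ⟨c, hcp, hc0, hc⟩ := exists_planar_solution hp1 hprec
  obtain ⟨v, hv, hv0, hv1⟩ := planar_limit_of_loopEquations hg
  have hcd : c = fun k => PowerSeries.mk fun i => v k (Finsupp.single 0 i) := by
    refine planar_solution_unique hc0 hc ?_ fun k => ?_
    · ext i
      rw [coeff_mk, hv0, sum_support_single_zero i v, map_add, coeff_one]
      simp
    · ext i
      rw [coeff_mk, hv1]
      have := sum_support_single_zero i fun j => v (k + 1 + j)
      simp only [← add_assoc] at this
      rw [this, map_add, map_add, coeff_mk, map_sum, Finsupp.antidiagonal_single]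
      congr 2
      refine sum_congr rfl fun ab _ => ?_
      simp [coeff_mul]
  have := hv 0 (Finsupp.single 0 m)
  have h2 : coeff m (c 0) = p (m + 1) := by rw [hcp, coeff_mk]
  rw [hcd, coeff_mk] at h2
  rwa [h2] at this

end PlanarLimit

section MomentSeries

/-- The divided-power monomial `∏ⱼ Qⱼ ^ Mⱼ / Mⱼ!`. -/
noncomputable def dividedMonomial {A : Type*} [CommRing A] [Algebra ℝ A] (Q : ℕ → A)
    (M : ℕ →₀ ℕ) : A :=
  M.prod fun j e => ((e.factorial : ℝ)⁻¹) • Q j ^ e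

/-- The loop equations, up to total weight `n`, for the moments `E`. -/
structure MomentLoopEquations {A : Type*} [CommRing A] [Algebra ℝ A] (n : ℕ) (E : A →ₗ[ℝ] ℝ)
    (Q : ℕ → A) : Prop where
  one : E 1 = 1
  zero : ∀ M, 1 + sourceWeight M ≤ n →
    E (Q 0 * dividedMonomial Q M) = (n : ℝ) ^ 2 * E (dividedMonomial Q M) +
      ∑ j ∈ M.support, ((j : ℝ) + 1) * E (Q (j + 1) * dividedMonomial Q (M - Finsupp.single j 1))
  succ : ∀ k M, k + 2 + sourceWeight M ≤ n →
    E (Q (k + 1) * dividedMonomial Q M) = E (Q k * dividedMonomial Q M) +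
      ((n : ℝ) ^ 2)⁻¹ * ∑ ab ∈ antidiagonal k, E (Q ab.1 * Q ab.2 * dividedMonomial Q M) +
      ∑ j ∈ M.support, ((j : ℝ) + 1) *
        E (Q (k + 1 + j + 1) * dividedMonomial Q (M - Finsupp.single j 1))

variable {A : Type*} [CommRing A] [Algebra ℝ A]

@[simp]
theorem dividedMonomial_zero (Q : ℕ → A) : dividedMonomial Q 0 = 1 := Finsupp.prod_zero_index

theorem dividedMonomial_single (Q : ℕ → A) (j e : ℕ) :
    dividedMonomial Q (Finsupp.single j e) = ((e.factorial : ℝ)⁻¹) • Q j ^ e :=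
  Finsupp.prod_single_index (by simp)

theorem smul_dividedMonomial_add_single (Q : ℕ → A) (M : ℕ →₀ ℕ) (j : ℕ) :
    ((M j : ℝ) + 1) • dividedMonomial Q (M + Finsupp.single j 1) = Q j * dividedMonomial Q M := by
  have h0 : ∀ i : ℕ, (((0 : ℕ).factorial : ℝ)⁻¹) • Q i ^ 0 = 1 := by simp
  unfold dividedMonomial
  rw [← Finsupp.mul_prod_erase' M j _ h0, ← Finsupp.mul_prod_erase' (M + Finsupp.single j 1) j _ h0,
    Finsupp.erase_add, Finsupp.erase_single, add_zero, Finsupp.add_apply, Finsupp.single_eq_same,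
    Nat.factorial_succ, pow_succ, ← smul_mul_assoc, smul_smul, ← mul_assoc]
  have : (M j : ℝ) + 1 ≠ 0 := by positivity
  congr 1
  push_cast
  rw [mul_inv, ← mul_assoc, mul_inv_cancel₀ this, one_mul, mul_comm (Q j), smul_mul_assoc]

/-- The generating series of the moments `E (f * ∏ⱼ Qⱼ ^ Mⱼ)`. -/
noncomputable def momentSeries (E : A →ₗ[ℝ] ℝ) (Q : ℕ → A) (f : A) : MvPowerSeries ℕ ℝ :=
  fun M => E (f * dividedMonomial Q M)

theorem coeff_momentSeries (E : A →ₗ[ℝ] ℝ) (Q : ℕ → A) (f : A) (M : ℕ →₀ ℕ) :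
    MvPowerSeries.coeff M (momentSeries E Q f) = E (f * dividedMonomial Q M) := rfl

theorem pderiv_momentSeries (E : A →ₗ[ℝ] ℝ) (Q : ℕ → A) (f : A) (j : ℕ) :
    MvPowerSeries.pderiv ℝ j (momentSeries E Q f) = momentSeries E Q (Q j * f) := by
  ext M
  rw [MvPowerSeries.coeff_pderiv, coeff_momentSeries, coeff_momentSeries, mul_comm (Q j) f,
    mul_assoc f, ← smul_dividedMonomial_add_single, mul_smul_comm, map_smul, smul_eq_mul, mul_comm]

theorem coeff_mul_eq_zero_of_sourceWeight_le {d : ℕ} {T : MvPowerSeries ℕ ℝ}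
    (hT : ∀ M, sourceWeight M ≤ d → MvPowerSeries.coeff M T = 0) (φ : MvPowerSeries ℕ ℝ)
    {M : ℕ →₀ ℕ} (hM : sourceWeight M ≤ d) : MvPowerSeries.coeff M (T * φ) = 0 := by
  rw [MvPowerSeries.coeff_mul]
  refine sum_eq_zero fun AB hAB => ?_
  have h := congrArg sourceWeight (mem_antidiagonal.1 hAB)
  rw [map_add] at h
  rw [hT AB.1 (by omega), zero_mul]

theorem coeff_sum_X_mul {n : ℕ} {M : ℕ →₀ ℕ} (hM : sourceWeight M ≤ n)
    (φ : ℕ → MvPowerSeries ℕ ℝ) :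
    MvPowerSeries.coeff M (∑ j ∈ range n, ((j : ℝ) + 1) • (MvPowerSeries.X j * φ j)) =
      ∑ j ∈ M.support, ((j : ℝ) + 1) * MvPowerSeries.coeff (M - Finsupp.single j 1) (φ j) := by
  rw [map_sum]
  have hsub : M.support ⊆ range n := fun j hj => by
    have := sourceWeight_sub_single hj
    exact mem_range.2 (by omega)
  refine (sum_subset_zero_on_sdiff hsub (fun j hj => ?_) fun j hj => ?_).symm
  · have hj' : M j = 0 := by simpa using (mem_sdiff.1 hj).2
    rw [MvPowerSeries.coeff_smul, MvPowerSeries.X, MvPowerSeries.coeff_monomial_mul, if_neg,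
      mul_zero]
    rw [Finsupp.single_le_iff, hj']
    omega
  · rw [MvPowerSeries.coeff_smul, MvPowerSeries.X, MvPowerSeries.coeff_monomial_mul, if_pos,
      one_mul]
    exact Finsupp.single_le_iff.2 (Nat.one_le_iff_ne_zero.2 (Finsupp.mem_support_iff.1 hj))

/-- The derivative in the `k`-th source of the free energy, divided by `n ^ 2`. -/
noncomputable def freeEnergyDeriv (n : ℕ) (E : A →ₗ[ℝ] ℝ) (Q : ℕ → A) (k : ℕ) :
    MvPowerSeries ℕ ℝ :=
  ((n : ℝ) ^ 2)⁻¹ • (momentSeries E Q (Q k) * (momentSeries E Q 1)⁻¹)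

theorem momentSeries_one_mul_inv {E : A →ₗ[ℝ] ℝ} (hE : E 1 = 1) (Q : ℕ → A) :
    momentSeries E Q 1 * (momentSeries E Q 1)⁻¹ = 1 := by
  refine MvPowerSeries.mul_inv_cancel _ ?_
  rw [← MvPowerSeries.coeff_zero_eq_constantCoeff_apply, coeff_momentSeries]
  simp [hE]

theorem momentSeries_eq_freeEnergyDeriv_mul {n : ℕ} (hn : 1 ≤ n) {E : A →ₗ[ℝ] ℝ} (hE : E 1 = 1)
    (Q : ℕ → A) (k : ℕ) :
    momentSeries E Q (Q k) =
      (n : ℝ) ^ 2 • (freeEnergyDeriv n E Q k * momentSeries E Q 1) := by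
  have hn' : (n : ℝ) ^ 2 ≠ 0 := by positivity
  rw [freeEnergyDeriv, smul_mul_assoc, smul_smul, mul_inv_cancel₀ hn', one_smul, mul_assoc,
    mul_comm _ (momentSeries E Q 1), momentSeries_one_mul_inv hE, mul_one]

theorem momentSeries_mul_eq {n : ℕ} (hn : 1 ≤ n) {E : A →ₗ[ℝ] ℝ} (hE : E 1 = 1)
    (Q : ℕ → A) (a b : ℕ) :
    (((n : ℝ) ^ 2)⁻¹ * ((n : ℝ) ^ 2)⁻¹) •
      (momentSeries E Q (Q a * Q b) * (momentSeries E Q 1)⁻¹) =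
      freeEnergyDeriv n E Q a * freeEnergyDeriv n E Q b +
        ((n : ℝ) ^ 2)⁻¹ • MvPowerSeries.pderiv ℝ a (freeEnergyDeriv n E Q b) := by
  have hn' : (n : ℝ) ^ 2 ≠ 0 := by positivity
  have h1 := momentSeries_eq_freeEnergyDeriv_mul hn hE Q a
  have hZ := momentSeries_one_mul_inv hE Q
  have h3 : MvPowerSeries.pderiv ℝ a (momentSeries E Q 1) = momentSeries E Q (Q a) := by
    rw [pderiv_momentSeries, mul_one]
  rw [← pderiv_momentSeries, momentSeries_eq_freeEnergyDeriv_mul hn hE Q b, Derivation.map_smul,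
    Derivation.leibniz, h3, h1]
  simp only [smul_eq_mul, smul_mul_assoc, mul_smul_comm, add_mul, smul_add, smul_smul]
  set G := freeEnergyDeriv n E Q
  set Z := momentSeries E Q 1
  have e1 : G b * (G a * Z) * Z⁻¹ = G a * G b := by linear_combination (G a * G b) * hZ
  have e2 : Z * MvPowerSeries.pderiv ℝ a (G b) * Z⁻¹ = MvPowerSeries.pderiv ℝ a (G b) := by
    linear_combination (MvPowerSeries.pderiv ℝ a (G b)) * hZ
  rw [e1, e2]
  congr 1
  · rw [show ((n : ℝ) ^ 2)⁻¹ * ((n : ℝ) ^ 2)⁻¹ * ((n : ℝ) ^ 2 * (n : ℝ) ^ 2) = 1 by field_simp,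
      one_smul]
  · congr 1; field_simp

theorem MomentLoopEquations.loopEquations {n : ℕ} (hn : 1 ≤ n) {E : A →ₗ[ℝ] ℝ} {Q : ℕ → A}
    (h : MomentLoopEquations n E Q) :
    LoopEquations n fun k M => MvPowerSeries.coeff M (freeEnergyDeriv n E Q k) := by
  have hn' : (n : ℝ) ^ 2 ≠ 0 := by positivity
  have hZ := momentSeries_one_mul_inv h.one Q
  constructor
  · intro M hM
    obtain ⟨T, hT⟩ : ∃ T, T = momentSeries E Q (Q 0) - (n : ℝ) ^ 2 • momentSeries E Q 1 -
      ∑ j ∈ range n, ((j : ℝ) + 1) • (MvPowerSeries.X j * momentSeries E Q (Q (j + 1))) :=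
      ⟨_, rfl⟩
    have hT0 : ∀ M, sourceWeight M ≤ n - 1 → MvPowerSeries.coeff M T = 0 := by
      intro M hM
      rw [hT, map_sub, map_sub, coeff_sum_X_mul (by omega), MvPowerSeries.coeff_smul]
      simp only [coeff_momentSeries, one_mul]
      rw [h.zero M (by omega)]
      ring
    have hT1 : ((n : ℝ) ^ 2)⁻¹ • (T * (momentSeries E Q 1)⁻¹) = freeEnergyDeriv n E Q 0 - 1 -
        ∑ j ∈ range n, ((j : ℝ) + 1) • (MvPowerSeries.X j * freeEnergyDeriv n E Q (j + 1)) := by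
      rw [hT, sub_mul, sub_mul, smul_mul_assoc, hZ, smul_sub, smul_sub, smul_smul,
        inv_mul_cancel₀ hn', one_smul, sum_mul, smul_sum]
      congr 1
      refine sum_congr rfl fun j _ => ?_
      rw [freeEnergyDeriv, smul_mul_assoc, mul_smul_comm, smul_comm, mul_assoc]
    have := congrArg (MvPowerSeries.coeff M) hT1
    rw [MvPowerSeries.coeff_smul, coeff_mul_eq_zero_of_sourceWeight_le hT0 _ (by omega), mul_zero,
      map_sub, map_sub, coeff_sum_X_mul (by omega), MvPowerSeries.coeff_one] at this
    linear_combination -this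
  · intro k M hM
    obtain ⟨T, hT⟩ : ∃ T, T = momentSeries E Q (Q (k + 1)) - momentSeries E Q (Q k) -
      ((n : ℝ) ^ 2)⁻¹ • ∑ ab ∈ antidiagonal k, momentSeries E Q (Q ab.1 * Q ab.2) -
      ∑ j ∈ range n, ((j : ℝ) + 1) •
        (MvPowerSeries.X j * momentSeries E Q (Q (k + 1 + j + 1))) := ⟨_, rfl⟩
    have hT0 : ∀ M, sourceWeight M ≤ n - (k + 2) → MvPowerSeries.coeff M T = 0 := by
      intro M hM
      rw [hT, map_sub, map_sub, map_sub, coeff_sum_X_mul (by omega), MvPowerSeries.coeff_smul,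
        map_sum]
      simp only [coeff_momentSeries]
      rw [h.succ k M (by omega)]
      ring
    have hT1 : ((n : ℝ) ^ 2)⁻¹ • (T * (momentSeries E Q 1)⁻¹) =
        freeEnergyDeriv n E Q (k + 1) - freeEnergyDeriv n E Q k -
        ∑ ab ∈ antidiagonal k, (freeEnergyDeriv n E Q ab.1 * freeEnergyDeriv n E Q ab.2 +
          ((n : ℝ) ^ 2)⁻¹ • MvPowerSeries.pderiv ℝ ab.1 (freeEnergyDeriv n E Q ab.2)) -
        ∑ j ∈ range n, ((j : ℝ) + 1) •
          (MvPowerSeries.X j * freeEnergyDeriv n E Q (k + 1 + j + 1)) := by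
      rw [hT, sub_mul, sub_mul, sub_mul, smul_sub, smul_sub, smul_sub, smul_mul_assoc, smul_smul,
        sum_mul, sum_mul, smul_sum, smul_sum]
      congr 1
      · congr 1
        exact sum_congr rfl fun ab _ => momentSeries_mul_eq hn h.one Q ab.1 ab.2
      · refine sum_congr rfl fun j _ => ?_
        rw [freeEnergyDeriv, smul_mul_assoc, mul_smul_comm, smul_comm, mul_assoc]
    have := congrArg (MvPowerSeries.coeff M) hT1
    rw [MvPowerSeries.coeff_smul, coeff_mul_eq_zero_of_sourceWeight_le hT0 _ (by omega), mul_zero,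
      map_sub, map_sub, map_sub, coeff_sum_X_mul (by omega), map_sum] at this
    simp only [map_add, MvPowerSeries.coeff_mul, MvPowerSeries.coeff_smul,
      MvPowerSeries.coeff_pderiv] at this
    rw [sum_congr rfl fun ab _ => by
      rw [mul_comm ((M ab.1 : ℝ) + 1)]]
    linear_combination -this

theorem moment_cumulant_of_momentLoopEquations {n : ℕ} (hn : 1 ≤ n) {E : A →ₗ[ℝ] ℝ} {Q : ℕ → A}
    (h : MomentLoopEquations n E Q) (m : ℕ) :
    E (Q 0 ^ (m + 1)) / m.factorial = (n : ℝ) ^ 2 * ∑ ij ∈ antidiagonal m,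
      MvPowerSeries.coeff (Finsupp.single 0 ij.1) (freeEnergyDeriv n E Q 0) *
        (E (Q 0 ^ ij.2) / ij.2.factorial) := by
  have := congrArg (MvPowerSeries.coeff (Finsupp.single 0 m))
    (momentSeries_eq_freeEnergyDeriv_mul hn h.one Q 0)
  rw [MvPowerSeries.coeff_smul, MvPowerSeries.coeff_mul, Finsupp.antidiagonal_single, sum_map,
    coeff_momentSeries, dividedMonomial_single, mul_smul_comm, map_smul, ← pow_succ',
    smul_eq_mul] at this
  rw [div_eq_inv_mul, this]
  congr 1
  refine sum_congr rfl fun ij _ => ?_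
  simp [coeff_momentSeries, dividedMonomial_single, div_eq_inv_mul]

end MomentSeries

section InverseGamma

/-- The one-variable weight `τ ^ (-3n) * exp (-n / τ)`. -/
noncomputable def delayWeight (n : ℕ) (τ : ℝ) : ℝ :=
  τ ^ (-(3 * (n : ℝ))) * Real.exp (-((n : ℝ) / τ))

theorem delayWeight_pos (n : ℕ) {τ : ℝ} (hτ : 0 < τ) : 0 < delayWeight n τ := by
  unfold delayWeight
  positivity

/-- The `k`-th moment of `delayWeight n`. -/
noncomputable def delayMoment (n k : ℕ) : ℝ := ∫ τ in Set.Ioi (0 : ℝ), τ ^ k * delayWeight n τ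

theorem pow_mul_delayWeight_eq (n k : ℕ) {x : ℝ} (hx : x ∈ Set.Ioi (0 : ℝ)) :
    (|(-1 : ℝ)| * x ^ ((-1 : ℝ) - 1)) • ((x ^ (-1 : ℝ)) ^ ((3 * (n : ℝ) - k - 1) - 1) *
      Real.exp (-((n : ℝ) * x ^ (-1 : ℝ)))) = x ^ k * delayWeight n x := by
  have hx : 0 < x := hx
  rw [delayWeight, ← Real.rpow_mul hx.le, abs_neg, abs_one, one_mul, smul_eq_mul, ← mul_assoc,
    ← mul_assoc, ← Real.rpow_natCast x k, ← Real.rpow_add hx, ← Real.rpow_add hx, Real.rpow_neg_one,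
    div_eq_mul_inv]
  ring_nf

theorem integrableOn_pow_mul_delayWeight {n k : ℕ} (hn : 1 ≤ n) (hk : k + 2 ≤ 3 * n) :
    IntegrableOn (fun τ => τ ^ k * delayWeight n τ) (Set.Ioi 0) := by
  have hk' : (k : ℝ) + 2 ≤ 3 * n := by exact_mod_cast hk
  have h := integrableOn_rpow_mul_exp_neg_mul_rpow (p := 1) (s := (3 * (n : ℝ) - k - 1) - 1)
    (b := n) (by linarith) one_pos (by positivity)
  simp only [Real.rpow_one, neg_mul] at h
  rw [← integrableOn_Ioi_comp_rpow_iff _ (show (-1 : ℝ) ≠ 0 by norm_num)] at h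
  exact h.congr_fun (fun x hx => pow_mul_delayWeight_eq n k hx) measurableSet_Ioi

theorem delayMoment_eq_Gamma {n k : ℕ} (hn : 1 ≤ n) (hk : k + 2 ≤ 3 * n) :
    delayMoment n k =
      (1 / (n : ℝ)) ^ (3 * (n : ℝ) - k - 1) * Real.Gamma (3 * (n : ℝ) - k - 1) := by
  have hk' : (k : ℝ) + 2 ≤ 3 * n := by exact_mod_cast hk
  rw [← Real.integral_rpow_mul_exp_neg_mul_Ioi (by linarith) (by positivity),
    ← integral_comp_rpow_Ioi _ (show (-1 : ℝ) ≠ 0 by norm_num)]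
  exact (setIntegral_congr_fun measurableSet_Ioi fun x hx => pow_mul_delayWeight_eq n k hx).symm

theorem delayMoment_succ {n k : ℕ} (hn : 1 ≤ n) (hk : k + 3 ≤ 3 * n) :
    (3 * (n : ℝ) - k - 2) * delayMoment n (k + 1) = n * delayMoment n k := by
  have hk' : (k : ℝ) + 3 ≤ 3 * n := by exact_mod_cast hk
  have hn' : (0 : ℝ) < n := by positivity
  rw [delayMoment_eq_Gamma hn (by omega), delayMoment_eq_Gamma hn (by omega)]
  push_cast
  have e : 3 * (n : ℝ) - k - 1 = (3 * (n : ℝ) - (k + 1) - 1) + 1 := by ring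
  rw [e, Real.Gamma_add_one (by linarith), Real.rpow_add (by positivity), Real.rpow_one]
  field_simp
  ring

end InverseGamma

section DelayFunctional

/-- The linear functional integrating a polynomial, monomial by monomial, against the product of the
weights `delayWeight n`. -/
noncomputable def delayFunctional (n : ℕ) : MvPolynomial (Fin n) ℝ →ₗ[ℝ] ℝ :=
  (MvPolynomial.basisMonomials (Fin n) ℝ).constr ℝ fun d => ∏ i, delayMoment n (d i)

theorem delayFunctional_monomial {n : ℕ} (d : Fin n →₀ ℕ) (r : ℝ) :
    delayFunctional n (MvPolynomial.monomial d r) = r * ∏ i, delayMoment n (d i) := by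
  rw [← mul_one r, ← smul_eq_mul r 1, ← MvPolynomial.smul_monomial, map_smul,
    ← congrFun (MvPolynomial.coe_basisMonomials (Fin n) ℝ) d, delayFunctional,
    Module.Basis.constr_basis]
  simp

theorem integral_eval_mul_delayWeight {n : ℕ} (hn : 1 ≤ n) {P : MvPolynomial (Fin n) ℝ}
    (hP : ∀ i, P.degreeOf i + 2 ≤ 3 * n) :
    IntegrableOn (fun τ => MvPolynomial.eval τ P * ∏ i, delayWeight n (τ i))
        (Set.univ.pi fun _ : Fin n => Set.Ioi (0 : ℝ)) ∧
      ∫ τ in Set.univ.pi (fun _ : Fin n => Set.Ioi (0 : ℝ)),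
        MvPolynomial.eval τ P * ∏ i, delayWeight n (τ i) = delayFunctional n P := by
  have hd : ∀ d ∈ P.support, ∀ i, d i + 2 ≤ 3 * n := fun d hd i =>
    (Nat.add_le_add_right (MvPolynomial.degreeOf_le_iff.1 le_rfl d hd) 2).trans (hP i)
  have hintegrable : ∀ d ∈ P.support, Integrable
      (fun τ : Fin n → ℝ => P.coeff d * ∏ i, (τ i ^ d i * delayWeight n (τ i)))
      (Measure.pi fun _ => volume.restrict (Set.Ioi (0 : ℝ))) := fun d hdP =>
    (Integrable.fintype_prod (f := fun i t => t ^ d i * delayWeight n t) fun i =>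
      integrableOn_pow_mul_delayWeight hn (hd d hdP i)).const_mul _
  have heq : (fun τ : Fin n → ℝ => MvPolynomial.eval τ P * ∏ i, delayWeight n (τ i)) =
      fun τ => ∑ d ∈ P.support, P.coeff d * ∏ i, (τ i ^ d i * delayWeight n (τ i)) := by
    funext τ
    rw [MvPolynomial.eval_eq', sum_mul]
    exact sum_congr rfl fun d _ => by rw [prod_mul_distrib, mul_assoc]
  rw [heq, IntegrableOn, volume_pi, Measure.restrict_pi_pi]
  refine ⟨integrable_finsetSum _ hintegrable, ?_⟩
  rw [integral_finsetSum _ hintegrable]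
  conv_rhs => rw [P.as_sum, map_sum]
  refine sum_congr rfl fun d _ => ?_
  rw [delayFunctional_monomial, integral_const_mul,
    integral_fintype_prod_eq_prod (fun i t => t ^ d i * delayWeight n t)]
  rfl

theorem delayFunctional_integration_by_parts {n : ℕ} (hn : 1 ≤ n) {i : Fin n}
    {P : MvPolynomial (Fin n) ℝ} (hP : P.degreeOf i + 3 ≤ 3 * n) :
    delayFunctional n (MvPolynomial.X i ^ 2 * MvPolynomial.pderiv i P +
      (2 - 3 * (n : ℝ)) • (MvPolynomial.X i * P) + (n : ℝ) • P) = 0 := by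
  have key : ∀ (d : Fin n →₀ ℕ) (r : ℝ), d i + 3 ≤ 3 * n →
      delayFunctional n (MvPolynomial.X i ^ 2 * MvPolynomial.pderiv i (MvPolynomial.monomial d r) +
        (2 - 3 * (n : ℝ)) • (MvPolynomial.X i * MvPolynomial.monomial d r) +
        (n : ℝ) • MvPolynomial.monomial d r) = 0 := by
    intro d r hd
    have e1 : MvPolynomial.X i * MvPolynomial.monomial d r =
        MvPolynomial.monomial (d + Finsupp.single i 1) r := by
      rw [MvPolynomial.X, MvPolynomial.monomial_mul, one_mul, add_comm]
    have e2 : MvPolynomial.X i ^ 2 * MvPolynomial.pderiv i (MvPolynomial.monomial d r) =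
        MvPolynomial.monomial (d + Finsupp.single i 1) (r * d i) := by
      rw [MvPolynomial.pderiv_monomial]
      rcases Nat.eq_zero_or_pos (d i) with h0 | h0
      · simp [h0]
      · rw [MvPolynomial.X_pow_eq_monomial, MvPolynomial.monomial_mul, one_mul]
        congr 2
        ext j
        by_cases hj : i = j
        · subst hj
          simp
          omega
        · simp [Finsupp.single_eq_of_ne' hj]
    rw [e1, e2, map_add, map_add, map_smul, map_smul, delayFunctional_monomial,
      delayFunctional_monomial, delayFunctional_monomial, ← mul_prod_erase univ _ (mem_univ i),
      ← mul_prod_erase univ (fun j => delayMoment n (d j)) (mem_univ i),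
      prod_congr rfl fun j hj => by
        rw [Finsupp.add_apply, Finsupp.single_eq_of_ne (ne_of_mem_erase hj), add_zero]]
    rw [Finsupp.add_apply, Finsupp.single_eq_same, smul_eq_mul, smul_eq_mul]
    linear_combination -(r * ∏ j ∈ univ.erase i, delayMoment n (d j)) * delayMoment_succ hn hd
  have hlin : ∀ s : Finset (Fin n →₀ ℕ), (∀ d ∈ s, d i + 3 ≤ 3 * n) →
      delayFunctional n
        (MvPolynomial.X i ^ 2 *
            MvPolynomial.pderiv i (∑ d ∈ s, MvPolynomial.monomial d (P.coeff d)) +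
          (2 - 3 * (n : ℝ)) •
            (MvPolynomial.X i * ∑ d ∈ s, MvPolynomial.monomial d (P.coeff d)) +
          (n : ℝ) • ∑ d ∈ s, MvPolynomial.monomial d (P.coeff d)) = 0 := by
    intro s hs
    rw [map_sum, mul_sum, mul_sum, smul_sum, smul_sum, ← sum_add_distrib, ← sum_add_distrib,
      map_sum]
    exact sum_eq_zero fun d hd => key d _ (hs d hd)
  have := hlin P.support fun d hd =>
    (Nat.add_le_add_right (MvPolynomial.degreeOf_le_iff.1 le_rfl d hd) 3).trans hP
  rwa [← P.as_sum] at this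

end DelayFunctional

section Derivations

variable {A : Type*} [CommRing A] [Algebra ℝ A]

theorem derivation_prod {ι : Type*} [DecidableEq ι] (D : Derivation ℝ A A) (u : ι → A)
    (s : Finset ι) : D (∏ i ∈ s, u i) = ∑ i ∈ s, (∏ j ∈ s.erase i, u j) * D (u i) := by
  induction s using Finset.induction_on with
  | empty => simp
  | insert a s ha ih =>
    rw [prod_insert ha, D.leibniz, ih, sum_insert ha, erase_insert ha, smul_eq_mul, smul_eq_mul,
      mul_sum, add_comm]
    congr 1
    refine sum_congr rfl fun i hi => ?_
    rw [erase_insert_of_ne (ne_of_mem_of_not_mem hi ha).symm,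
      prod_insert fun h => ha (mem_of_mem_erase h), mul_assoc]

theorem derivation_prod_of_eq_mul {ι : Type*} (D : Derivation ℝ A A) {u h : ι → A} {s : Finset ι}
    (H : ∀ i ∈ s, D (u i) = u i * h i) : D (∏ i ∈ s, u i) = (∏ i ∈ s, u i) * ∑ i ∈ s, h i := by
  classical
  rw [derivation_prod, mul_sum]
  refine sum_congr rfl fun i hi => ?_
  rw [H i hi, ← mul_assoc, prod_erase_mul _ _ hi]

theorem derivation_dividedMonomial (D : Derivation ℝ A A) (Q : ℕ → A) (M : ℕ →₀ ℕ) :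
    D (dividedMonomial Q M) =
      ∑ j ∈ M.support, dividedMonomial Q (M - Finsupp.single j 1) * D (Q j) := by
  have h0 : ∀ i : ℕ, (((0 : ℕ).factorial : ℝ)⁻¹) • Q i ^ 0 = 1 := by simp
  rw [dividedMonomial, Finsupp.prod, derivation_prod]
  refine sum_congr rfl fun j hj => ?_
  obtain ⟨e, he⟩ := Nat.exists_eq_succ_of_ne_zero (Finsupp.mem_support_iff.1 hj)
  have hM : (M - Finsupp.single j 1 : ℕ →₀ ℕ) j = e := by simp [he]
  have hM' : (M - Finsupp.single j 1 : ℕ →₀ ℕ).erase j = M.erase j := by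
    ext i
    by_cases hi : i = j
    · simp [hi]
    · simp [Finsupp.erase_ne hi, Finsupp.single_eq_of_ne hi]
  have he0 : (e.factorial : ℝ) ≠ 0 := by positivity
  rw [dividedMonomial, ← Finsupp.mul_prod_erase' _ j _ h0, hM, hM', Finsupp.prod,
    Finsupp.support_erase, prod_congr rfl fun i hi => by
      rw [← Finsupp.erase_ne (f := M) (ne_of_mem_erase hi)], D.map_smul, D.leibniz_pow, he,
    Nat.succ_sub_one, smul_eq_mul, Nat.factorial_succ, ← Nat.cast_smul_eq_nsmul ℝ, smul_smul,
    smul_mul_assoc, mul_smul_comm, smul_mul_assoc]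
  congr 1
  · push_cast
    field_simp
  · ring

end Derivations

section VandermondePolynomial

open MvPolynomial

/-- The Vandermonde product `∏_{i<j} (X_j - X_i)`. -/
noncomputable def vandPoly (n : ℕ) : MvPolynomial (Fin n) ℝ :=
  ∏ i, ∏ j ∈ Ioi i, (X j - X i)

/-- The derivation `∑ᵢ Xᵢ ^ (κ + 2) ∂ᵢ`. -/
noncomputable def powerDerivation (n κ : ℕ) :
    Derivation ℝ (MvPolynomial (Fin n) ℝ) (MvPolynomial (Fin n) ℝ) :=
  mkDerivation ℝ fun i => X i ^ (κ + 2)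

theorem powerDerivation_apply {n : ℕ} (κ : ℕ) (f : MvPolynomial (Fin n) ℝ) :
    powerDerivation n κ f = ∑ i, X i ^ (κ + 2) * pderiv i f := by
  have hsum : ∀ g : MvPolynomial (Fin n) ℝ,
      (∑ i, (X i : MvPolynomial (Fin n) ℝ) ^ (κ + 2) • pderiv (R := ℝ) i) g =
        ∑ i, X i ^ (κ + 2) * pderiv i g := fun g => by
    rw [← Derivation.coeFnAddMonoidHom_apply, map_sum, Finset.sum_apply]
    rfl
  rw [← hsum]
  refine Derivation.congr_fun (derivation_ext fun j => ?_) f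
  rw [hsum, powerDerivation, mkDerivation_X, sum_eq_single j (fun i _ hij => by
    rw [pderiv_X_of_ne hij.symm, mul_zero]) (by simp), pderiv_X_self, mul_one]

theorem powerDerivation_psum (n κ j : ℕ) :
    powerDerivation n κ (psum (Fin n) ℝ (j + 1)) =
      ((j : ℝ) + 1) • psum (Fin n) ℝ (j + κ + 2) := by
  rw [psum, psum, map_sum, smul_sum]
  refine sum_congr rfl fun i _ => ?_
  rw [Derivation.leibniz_pow, powerDerivation, mkDerivation_X, Nat.add_sub_cancel, smul_eq_mul,
    ← pow_add, ← Nat.cast_smul_eq_nsmul ℝ, Nat.cast_succ]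
  congr 2

theorem sum_antidiagonal_pow_mul_sub {R : Type*} [CommRing R] (x y : R) (m : ℕ) :
    (x - y) * ∑ ab ∈ antidiagonal m, x ^ ab.1 * y ^ ab.2 = x ^ (m + 1) - y ^ (m + 1) := by
  rw [← geom_sum₂_mul, mul_comm, Nat.sum_antidiagonal_eq_sum_range_succ_mk]
  rfl

theorem two_mul_sum_Ioi_antidiagonal (n m : ℕ) :
    2 * ∑ i : Fin n, ∑ j ∈ Ioi i, ∑ ab ∈ antidiagonal m,
        (X j ^ ab.1 * X i ^ ab.2 : MvPolynomial (Fin n) ℝ) =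
      ∑ ab ∈ antidiagonal m, psum (Fin n) ℝ ab.1 * psum (Fin n) ℝ ab.2 -
        ((m : ℝ) + 1) • psum (Fin n) ℝ m := by
  have hsymm : ∀ i j : Fin n, ∑ ab ∈ antidiagonal m,
      (X j ^ ab.1 * X i ^ ab.2 : MvPolynomial (Fin n) ℝ) =
      ∑ ab ∈ antidiagonal m, X i ^ ab.1 * X j ^ ab.2 := fun i j => by
    rw [← Nat.sum_antidiagonal_swap]
    exact sum_congr rfl fun ab _ => mul_comm _ _
  have hoff := sum_sum_Ioi_add_eq_sum_sum_off_diag fun j i : Fin n => ∑ ab ∈ antidiagonal m,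
      (X j ^ ab.1 * X i ^ ab.2 : MvPolynomial (Fin n) ℝ)
  have hdiag : ∀ i : Fin n, ∑ ab ∈ antidiagonal m,
      (X i ^ ab.1 * X i ^ ab.2 : MvPolynomial (Fin n) ℝ) = ((m : ℝ) + 1) • X i ^ m := fun i => by
    rw [sum_congr rfl fun ab hab => by rw [← pow_add, mem_antidiagonal.1 hab], sum_const,
      Nat.card_antidiagonal, ← Nat.cast_smul_eq_nsmul ℝ, Nat.cast_succ]
  have hall : ∑ ab ∈ antidiagonal m, psum (Fin n) ℝ ab.1 * psum (Fin n) ℝ ab.2 =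
      ∑ i : Fin n, ∑ j, ∑ ab ∈ antidiagonal m, X j ^ ab.1 * X i ^ ab.2 := by
    simp_rw [psum, sum_mul_sum]
    rw [sum_comm, sum_congr rfl fun j _ => sum_comm, sum_comm]
  rw [hall, psum, smul_sum, ← sum_sub_distrib, mul_sum]
  simp_rw [← hdiag]
  refine Eq.trans (sum_congr rfl fun i _ => ?_) (hoff.trans (sum_congr rfl fun i _ => ?_))
  · rw [mul_sum]
    exact sum_congr rfl fun j _ => by rw [two_mul, ← hsymm i j]
  · rw [eq_sub_iff_add_eq, ← sum_singleton (fun j : Fin n => ∑ ab ∈ antidiagonal m,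
      (X j ^ ab.1 * X i ^ ab.2 : MvPolynomial (Fin n) ℝ)) i, add_comm, sum_add_sum_compl]

theorem powerDerivation_vandPoly (n κ : ℕ) :
    powerDerivation n κ (vandPoly n) = vandPoly n *
      ∑ i : Fin n, ∑ j ∈ Ioi i, ∑ ab ∈ antidiagonal (κ + 1), X j ^ ab.1 * X i ^ ab.2 := by
  refine derivation_prod_of_eq_mul _ fun i _ => derivation_prod_of_eq_mul _ fun j _ => ?_
  rw [sum_antidiagonal_pow_mul_sub, Derivation.map_sub, powerDerivation, mkDerivation_X,
    mkDerivation_X]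

theorem degreeOf_vandPoly_le {n : ℕ} (i : Fin n) : (vandPoly n).degreeOf i + 1 ≤ n := by
  have h1 : ∀ a b : Fin n, (X b - X a : MvPolynomial (Fin n) ℝ).degreeOf i ≤
      (if b = i then 1 else 0) + if a = i then 1 else 0 := fun a b => by
    refine (degreeOf_sub_le i _ _).trans ?_
    rw [degreeOf_X, degreeOf_X]
    simp only [eq_comm (a := i)]
    exact max_le (Nat.le_add_right _ _) (Nat.le_add_left _ _)
  have h2 : (vandPoly n).degreeOf i ≤ ∑ a : Fin n, ∑ b ∈ ({a}ᶜ : Finset (Fin n)),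
      if a = i then 1 else 0 := by
    rw [← sum_sum_Ioi_add_eq_sum_sum_off_diag fun b a => if a = i then 1 else 0]
    refine (degreeOf_prod_le _ _ _).trans (sum_le_sum fun a _ => ?_)
    refine (degreeOf_prod_le _ _ _).trans (sum_le_sum fun b _ => ?_)
    rw [add_comm]
    exact h1 a b
  have h3 : ∑ a : Fin n, ∑ b ∈ ({a}ᶜ : Finset (Fin n)), (if a = i then 1 else 0) = n - 1 := by
    simp [card_compl]
  have := i.pos
  omega

theorem degreeOf_dividedMonomial_le {n : ℕ} {Q : ℕ → MvPolynomial (Fin n) ℝ} {i : Fin n}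
    (hQ : ∀ j, (Q j).degreeOf i ≤ j + 1) (M : ℕ →₀ ℕ) :
    (dividedMonomial Q M).degreeOf i ≤ sourceWeight M := by
  rw [sourceWeight, Finsupp.weight_apply, dividedMonomial]
  refine (degreeOf_prod_le _ _ _).trans (sum_le_sum fun j _ => ?_)
  simp only [smul_eq_C_mul, smul_eq_mul]
  exact (degreeOf_C_mul_le _ _ _).trans ((degreeOf_pow_le _ _ _).trans
    (Nat.mul_le_mul_left _ (hQ j)))

theorem degreeOf_psum_le {n : ℕ} (i : Fin n) (j : ℕ) : (psum (Fin n) ℝ j).degreeOf i ≤ j := by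
  refine (degreeOf_sum_le _ _ _).trans (Finset.sup_le fun a _ => ?_)
  refine (degreeOf_pow_le _ _ _).trans ?_
  rw [degreeOf_X]
  split_ifs <;> simp

end VandermondePolynomial

section SchwingerDyson

open MvPolynomial

theorem powerDerivation_vandPoly_sq (n κ : ℕ) :
    powerDerivation n κ (vandPoly n ^ 2) = vandPoly n ^ 2 *
      (∑ ab ∈ antidiagonal (κ + 1), psum (Fin n) ℝ ab.1 * psum (Fin n) ℝ ab.2 -
        ((κ : ℝ) + 2) • psum (Fin n) ℝ (κ + 1)) := by
  have h := two_mul_sum_Ioi_antidiagonal n (κ + 1)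
  rw [Nat.cast_succ, add_assoc, one_add_one_eq_two] at h
  rw [← h, pow_two, Derivation.leibniz, powerDerivation_vandPoly, smul_eq_mul]
  ring

theorem delayFunctional_schwinger_dyson {n κ : ℕ} {f : MvPolynomial (Fin n) ℝ} (hn : 1 ≤ n)
    (hf : ∀ i, f.degreeOf i + κ + 1 ≤ n) :
    delayFunctional n
      ((∑ ab ∈ antidiagonal (κ + 1), psum (Fin n) ℝ ab.1 * psum (Fin n) ℝ ab.2 * f -
        (3 * (n : ℝ)) • (psum (Fin n) ℝ (κ + 1) * f) + (n : ℝ) • (psum (Fin n) ℝ κ * f) +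
        powerDerivation n κ f) * vandPoly n ^ 2) = 0 := by
  have hdeg : ∀ i, (X i ^ κ * (f * vandPoly n ^ 2)).degreeOf i + 3 ≤ 3 * n := fun i => by
    have h1 := degreeOf_mul_le i (X i ^ κ) (f * vandPoly n ^ 2)
    have h2 := degreeOf_mul_le i f (vandPoly n ^ 2)
    have h3 := degreeOf_pow_le i (vandPoly n) 2
    have h4 := degreeOf_vandPoly_le i
    have h5 := hf i
    rw [degreeOf_X_self_pow] at h1
    omega
  have hpd : ∀ i, X i ^ 2 * pderiv i (X i ^ κ * (f * vandPoly n ^ 2)) =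
      X i ^ (κ + 2) * pderiv i (f * vandPoly n ^ 2) +
        (κ : ℝ) • (X i ^ (κ + 1) * (f * vandPoly n ^ 2)) := fun i => by
    rw [Derivation.leibniz, Derivation.leibniz_pow, pderiv_X_self, ← Nat.cast_smul_eq_nsmul ℝ]
    rcases κ with _ | κ
    · simp
    · simp only [smul_eq_mul, mul_one, Nat.add_sub_cancel, mul_add, mul_smul_comm]
      ring_nf
  have hsum := sum_eq_zero fun i (_ : i ∈ univ) =>
    delayFunctional_integration_by_parts hn (hdeg i)
  rw [← map_sum] at hsum
  rw [← hsum]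
  congr 1
  simp_rw [hpd]
  rw [sum_add_distrib, sum_add_distrib, sum_add_distrib, ← powerDerivation_apply,
    Derivation.leibniz, powerDerivation_vandPoly_sq]
  simp_rw [← mul_assoc (X _) (X _ ^ κ), ← pow_succ', ← smul_sum, ← sum_mul, ← psum.eq_1,
    smul_eq_C_mul, smul_eq_mul]
  simp only [map_add, map_sub, map_mul, map_ofNat]
  ring

/-- The scaled power sum `n * ∑ᵢ Xᵢ ^ (j + 1)`. -/
noncomputable def scaledPsum (n j : ℕ) : MvPolynomial (Fin n) ℝ :=
  (n : ℝ) • psum (Fin n) ℝ (j + 1)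

/-- The expectation of a polynomial in the delay times. -/
noncomputable def delayExpectation (n : ℕ) : MvPolynomial (Fin n) ℝ →ₗ[ℝ] ℝ :=
  (delayFunctional n (vandPoly n ^ 2))⁻¹ •
    (delayFunctional n).comp (LinearMap.mulRight ℝ (vandPoly n ^ 2))

theorem delayExpectation_apply {n : ℕ} (f : MvPolynomial (Fin n) ℝ) :
    delayExpectation n f =
      (delayFunctional n (vandPoly n ^ 2))⁻¹ * delayFunctional n (f * vandPoly n ^ 2) := rfl

theorem powerDerivation_scaledPsum (n κ j : ℕ) :
    powerDerivation n κ (scaledPsum n j) = ((j : ℝ) + 1) • scaledPsum n (κ + j + 1) := by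
  rw [scaledPsum, scaledPsum, Derivation.map_smul, powerDerivation_psum, smul_comm,
    add_comm κ j, add_assoc (j + κ)]

theorem degreeOf_scaledPsum_le {n : ℕ} (i : Fin n) (j : ℕ) :
    (scaledPsum n j).degreeOf i ≤ j + 1 := by
  rw [scaledPsum, smul_eq_C_mul]
  exact (degreeOf_C_mul_le _ _ _).trans (degreeOf_psum_le i (j + 1))

theorem delayExpectation_scaledPsum_mul {n κ : ℕ} (hn : 1 ≤ n) {M : ℕ →₀ ℕ}
    (hM : κ + 1 + sourceWeight M ≤ n) :
    delayExpectation n (scaledPsum n κ * dividedMonomial (scaledPsum n) M) =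
      delayExpectation n (∑ ab ∈ antidiagonal (κ + 1), psum (Fin n) ℝ ab.1 * psum (Fin n) ℝ ab.2 *
        dividedMonomial (scaledPsum n) M) -
      2 * n * delayExpectation n
        (psum (Fin n) ℝ (κ + 1) * dividedMonomial (scaledPsum n) M) +
      n * delayExpectation n (psum (Fin n) ℝ κ * dividedMonomial (scaledPsum n) M) +
      ∑ j ∈ M.support, ((j : ℝ) + 1) * delayExpectation n
        (scaledPsum n (κ + j + 1) * dividedMonomial (scaledPsum n) (M - Finsupp.single j 1)) := by
  set f := dividedMonomial (scaledPsum n) M with hf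
  have hdeg : ∀ i, f.degreeOf i + κ + 1 ≤ n := fun i => by
    have := degreeOf_dividedMonomial_le (degreeOf_scaledPsum_le i) M
    rw [← hf] at this
    omega
  have hD : ∑ j ∈ M.support, ((j : ℝ) + 1) * delayExpectation n
      (scaledPsum n (κ + j + 1) * dividedMonomial (scaledPsum n) (M - Finsupp.single j 1)) =
      delayExpectation n (powerDerivation n κ f) := by
    rw [hf, derivation_dividedMonomial, map_sum]
    refine sum_congr rfl fun j _ => ?_
    rw [powerDerivation_scaledPsum, mul_smul_comm, map_smul, smul_eq_mul, mul_comm (scaledPsum _ _)]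
  have h := congrArg ((delayFunctional n (vandPoly n ^ 2))⁻¹ * ·)
    (delayFunctional_schwinger_dyson hn hdeg)
  simp only [← delayExpectation_apply, map_add, map_sub, map_smul, smul_eq_mul, mul_zero] at h
  rw [hD, scaledPsum, smul_mul_assoc, map_smul, smul_eq_mul]
  linear_combination -h

theorem delayExpectation_momentLoopEquations {n : ℕ} (hn : 1 ≤ n)
    (h0 : delayFunctional n (vandPoly n ^ 2) ≠ 0) :
    MomentLoopEquations n (delayExpectation n) (scaledPsum n) := by
  have hn' : (n : ℝ) ≠ 0 := by positivity
  have hp0 : psum (Fin n) ℝ 0 = C (n : ℝ) := by rw [psum_zero, Fintype.card_fin, map_natCast]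
  have hQ : ∀ j, psum (Fin n) ℝ (j + 1) = (n : ℝ)⁻¹ • scaledPsum n j := fun j => by
    rw [scaledPsum, smul_smul, inv_mul_cancel₀ hn', one_smul]
  refine ⟨?_, fun M hM => ?_, fun k M hM => ?_⟩
  · rw [delayExpectation_apply, one_mul, inv_mul_cancel₀ h0]
  · rw [delayExpectation_scaledPsum_mul hn (by omega), Nat.sum_antidiagonal_succ,
      Nat.antidiagonal_zero, sum_singleton, hp0]
    simp only [← smul_eq_C_mul, mul_comm _ (C (n : ℝ)), smul_mul_assoc, map_add, map_smul,
      smul_eq_mul, zero_add]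
    ring
  · rw [delayExpectation_scaledPsum_mul hn (by omega), Nat.sum_antidiagonal_succ,
      Nat.sum_antidiagonal_succ', hp0]
    simp only [hQ]
    simp only [← smul_eq_C_mul, mul_comm _ (C (n : ℝ)), smul_mul_assoc, mul_smul_comm, map_add,
      map_sum, map_smul, smul_eq_mul, ← mul_sum]
    field_simp
    ring

end SchwingerDyson

section Identification

open MvPolynomial

theorem eval_vandPoly_sq {n : ℕ} (τ : Fin n → ℝ) : eval τ (vandPoly n ^ 2) = vand 2 τ := by
  rw [map_pow, vandPoly, map_prod, ← prod_pow, vand]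
  refine prod_congr rfl fun i _ => ?_
  rw [map_prod, ← prod_pow]
  refine prod_congr rfl fun j _ => ?_
  rw [Real.rpow_two, sq_abs, map_sub, eval_X, eval_X]

theorem degreeOf_mul_vandPoly_sq_le {n : ℕ} {f : MvPolynomial (Fin n) ℝ}
    (hf : ∀ i, f.degreeOf i ≤ n) (i : Fin n) :
    (f * vandPoly n ^ 2).degreeOf i + 2 ≤ 3 * n := by
  have h1 := degreeOf_mul_le i f (vandPoly n ^ 2)
  have h2 := degreeOf_pow_le i (vandPoly n) 2
  have h3 := degreeOf_vandPoly_le i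
  have h4 := hf i
  omega

theorem delayFunctional_vandPoly_sq_pos {n : ℕ} (hn : 1 ≤ n) :
    0 < delayFunctional n (vandPoly n ^ 2) := by
  obtain ⟨hintegrable, heq⟩ := integral_eval_mul_delayWeight hn
    (degreeOf_mul_vandPoly_sq_le (f := 1) fun i => by simp)
  rw [one_mul] at hintegrable heq
  have hmeas : MeasurableSet (Set.univ.pi fun _ : Fin n => Set.Ioi (0 : ℝ)) :=
    .univ_pi fun _ => measurableSet_Ioi
  have hw : ∀ τ ∈ Set.univ.pi fun _ : Fin n => Set.Ioi (0 : ℝ),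
      0 < ∏ i, delayWeight n (τ i) := fun τ hτ =>
    prod_pos fun i _ => delayWeight_pos n (hτ i (Set.mem_univ i))
  rw [← heq, setIntegral_pos_iff_support_of_nonneg_ae _ hintegrable]
  · have hopen : IsOpen ({τ : Fin n → ℝ | eval τ (vandPoly n) ≠ 0} ∩
        Set.univ.pi fun _ : Fin n => Set.Ioi (0 : ℝ)) :=
      (isOpen_ne_fun (MvPolynomial.continuous_eval _) continuous_const).inter
        (isOpen_set_pi Set.finite_univ fun _ _ => isOpen_Ioi)
    refine (hopen.measure_pos volume ⟨fun i => (i : ℝ) + 1, ?_, fun i _ => ?_⟩).trans_le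
      (measure_mono fun τ hτ => ⟨?_, hτ.2⟩)
    · rw [Set.mem_ofPred_eq, vandPoly, map_prod]
      refine prod_ne_zero_iff.2 fun i _ => ?_
      rw [map_prod]
      refine prod_ne_zero_iff.2 fun j hj => ?_
      rw [map_sub, eval_X, eval_X, add_sub_add_right_eq_sub, sub_ne_zero]
      exact Nat.cast_injective.ne (Fin.val_injective.ne (mem_Ioi.1 hj).ne')
    · exact Set.mem_Ioi.2 (by positivity)
    · rw [Function.mem_support, map_pow]
      exact mul_ne_zero (pow_ne_zero 2 hτ.1) (hw τ hτ.2).ne'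
  · filter_upwards [ae_restrict_mem hmeas] with τ hτ
    rw [map_pow]
    exact mul_nonneg (sq_nonneg _) (hw τ hτ).le

theorem wigMoment_eq_delayExpectation {n j : ℕ} (hn : 1 ≤ n) (hj : j ≤ n) :
    wigMoment n j = delayExpectation n (((1 / (n : ℝ)) • psum (Fin n) ℝ 1) ^ j) := by
  have hdeg : ∀ i, (((1 / (n : ℝ)) • psum (Fin n) ℝ 1) ^ j).degreeOf i ≤ n := fun i => by
    refine (((degreeOf_pow_le _ _ _).trans (Nat.mul_le_mul_left _ ?_)).trans_eq
      (mul_one j)).trans hj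
    rw [smul_eq_C_mul]
    exact (degreeOf_C_mul_le _ _ _).trans (degreeOf_psum_le i 1)
  rw [delayExpectation_apply, wigMoment, div_eq_inv_mul,
    ← (integral_eval_mul_delayWeight hn (degreeOf_mul_vandPoly_sq_le hdeg)).2]
  have h1 := (integral_eval_mul_delayWeight hn
    (degreeOf_mul_vandPoly_sq_le (f := 1) fun i => by simp)).2
  rw [one_mul] at h1
  rw [← h1]
  congr 2
  · congr 1
    funext τ
    rw [eval_vandPoly_sq, mul_comm]
    rfl
  · funext τ
    rw [map_mul, eval_vandPoly_sq, map_pow, smul_eq_C_mul, map_mul, eval_C, psum_one, map_sum]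
    simp only [eval_X, delayWeight]
    ring

theorem delayExpectation_scaledPsum_zero_pow {n j : ℕ} (hn : 1 ≤ n) (hj : j ≤ n) :
    delayExpectation n (scaledPsum n 0 ^ j) = ((n : ℝ) ^ 2) ^ j * wigMu n j := by
  have hn' : (n : ℝ) ≠ 0 := by positivity
  have h : wigMu n j = delayExpectation n (((1 / (n : ℝ)) • psum (Fin n) ℝ 1) ^ j) := by
    rw [wigMu]
    split_ifs with h
    · rw [h, pow_zero, delayExpectation_apply, one_mul,
        inv_mul_cancel₀ (delayFunctional_vandPoly_sq_pos hn).ne']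
    · exact wigMoment_eq_delayExpectation hn hj
  rw [h, ← smul_eq_mul, ← map_smul, ← smul_pow, smul_smul, scaledPsum]
  congr 3
  field_simp

end Identification

section Cumulants

theorem eq_of_sum_choose_mul_eq {n : ℕ} {a b μ : ℕ → ℝ} (hμ : μ 0 = 1)
    (h : ∀ m < n, ∑ ij ∈ antidiagonal m, (m.choose ij.2 : ℝ) * a ij.1 * μ ij.2 =
      ∑ ij ∈ antidiagonal m, (m.choose ij.2 : ℝ) * b ij.1 * μ ij.2) (m : ℕ) (hm : m < n) :
    a m = b m := by
  induction m using Nat.strong_induction_on with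
  | _ m ih =>
    have hmem : (m, 0) ∈ antidiagonal m := by simp
    have hrest : ∑ ij ∈ (antidiagonal m).erase (m, 0), (m.choose ij.2 : ℝ) * a ij.1 * μ ij.2 =
        ∑ ij ∈ (antidiagonal m).erase (m, 0), (m.choose ij.2 : ℝ) * b ij.1 * μ ij.2 := by
      refine sum_congr rfl fun ij hij => ?_
      have h1 := mem_antidiagonal.1 (mem_of_mem_erase hij)
      have h2 : ij.1 ≠ m := fun h2 => ne_of_mem_erase hij (Prod.ext h2 (by simp; omega))
      rw [ih ij.1 (by omega) (by omega)]
    have := h m hm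
    rw [← add_sum_erase _ _ hmem, ← add_sum_erase (antidiagonal m) _ hmem, hrest] at this
    simp only [Nat.choose_zero_right, hμ, Nat.cast_one, one_mul, mul_one] at this
    exact add_right_cancel this

theorem wigMu_succ_eq_sum_antidiagonal {n m : ℕ} (hm : m < n) :
    wigMu n (m + 1) = ∑ ij ∈ antidiagonal m, (m.choose ij.2 : ℝ) *
      ((ij.1.factorial : ℝ) * MvPowerSeries.coeff (Finsupp.single 0 ij.1)
        (freeEnergyDeriv n (delayExpectation n) (scaledPsum n) 0) / ((n : ℝ) ^ 2) ^ ij.1) *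
      wigMu n ij.2 := by
  have hn : 1 ≤ n := by omega
  have hn' : (n : ℝ) ≠ 0 := by positivity
  have h := moment_cumulant_of_momentLoopEquations hn
    (delayExpectation_momentLoopEquations hn (delayFunctional_vandPoly_sq_pos hn).ne') m
  rw [delayExpectation_scaledPsum_zero_pow hn hm, div_eq_iff (by positivity)] at h
  refine mul_left_cancel₀ (pow_ne_zero (m + 1) (pow_ne_zero 2 hn')) ?_
  rw [h, mul_sum, mul_sum, sum_mul]
  refine sum_congr rfl fun ij hij => ?_
  have hij' := mem_antidiagonal.1 hij
  rw [delayExpectation_scaledPsum_zero_pow hn (by omega), ← hij', Nat.add_choose,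
    Nat.cast_div (Nat.factorial_mul_factorial_dvd_factorial_add _ _) (by positivity)]
  push_cast
  field_simp
  ring

theorem cumulant_eq_coeff_freeEnergyDeriv {K : ℕ → ℕ → ℝ}
    (hK : ∀ n l : ℕ, 1 ≤ l → l ≤ n →
      wigMu n l = ∑ j ∈ Finset.range l, (Nat.choose (l - 1) j : ℝ) * K (l - j) n * wigMu n j)
    {n m : ℕ} (hm : m < n) :
    K (m + 1) n = (m.factorial : ℝ) * MvPowerSeries.coeff (Finsupp.single 0 m)
      (freeEnergyDeriv n (delayExpectation n) (scaledPsum n) 0) / ((n : ℝ) ^ 2) ^ m := by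
  refine eq_of_sum_choose_mul_eq (a := fun i => K (i + 1) n) (b := fun i =>
    (i.factorial : ℝ) * MvPowerSeries.coeff (Finsupp.single 0 i)
      (freeEnergyDeriv n (delayExpectation n) (scaledPsum n) 0) / ((n : ℝ) ^ 2) ^ i)
    (μ := wigMu n) (if_pos rfl) (fun m hm => ?_) m hm
  rw [← wigMu_succ_eq_sum_antidiagonal hm, hK n (m + 1) (by omega) hm, ← Nat.sum_antidiagonal_swap,
    Nat.sum_antidiagonal_eq_sum_range_succ_mk]
  refine sum_congr rfl fun j hj => ?_
  have := mem_range.1 hj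
  simp only [Prod.swap_prod_mk, Nat.add_sub_cancel]
  rw [Nat.sub_add_comm (by omega)]

end Cumulants

/-- For β = 2, the cumulants `K_l(n)` of the Wigner delay time (defined from the moments
by the standard moment–cumulant recursion) satisfy
`n^{2l−2} K_l(n)/(l−1)! → p_l`, where `(p_l)` solves the limiting recurrence
`(l+1)p_{l+1} = 2(2l−1)p_l + 2∑_{i=0}^{l−1}(3i+1)(l−i)p_{i+1}p_{l−i}` with `p_1 = 1`. -/
theorem wigner_cumulant_leading_asymptotics
    (K : ℕ → ℕ → ℝ)
    (hK : ∀ n l : ℕ, 1 ≤ l → l ≤ n →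
      wigMu n l = ∑ j ∈ Finset.range l, (Nat.choose (l - 1) j : ℝ) * K (l - j) n * wigMu n j)
    (p : ℕ → ℝ) (hp1 : p 1 = 1)
    (hprec : ∀ l : ℕ, 1 ≤ l →
      ((l : ℝ) + 1) * p (l + 1)
        = 2 * (2 * (l : ℝ) - 1) * p l
          + 2 * ∑ i ∈ Finset.range l,
              (3 * (i : ℝ) + 1) * ((l : ℝ) - (i : ℝ)) * p (i + 1) * p (l - i))
    (l : ℕ) (hl : 1 ≤ l) :
    Tendsto (fun n : ℕ => (n : ℝ) ^ (2 * l - 2) * K l n / (Nat.factorial (l - 1) : ℝ))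
      atTop (nhds (p l)) := by
  obtain ⟨m, rfl⟩ := Nat.exists_eq_add_of_le' hl
  have hlim := tendsto_of_loopEquations hp1 hprec
    (g := fun n k M => MvPowerSeries.coeff M
      (freeEnergyDeriv n (delayExpectation n) (scaledPsum n) k))
    (fun n hn => (delayExpectation_momentLoopEquations hn
      (delayFunctional_vandPoly_sq_pos hn).ne').loopEquations hn) m
  refine hlim.congr' ?_
  filter_upwards [eventually_gt_atTop m] with n hn
  have hn' : (n : ℝ) ≠ 0 := by
    have : 1 ≤ n := by omega
    positivity
  rw [cumulant_eq_coeff_freeEnergyDeriv hK hn, Nat.add_sub_cancel,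
    show 2 * (m + 1) - 2 = 2 * m by omega, pow_mul]
  field_simp
end

section
/- For integers l ≥ 2 and k ≥ 0, define x_{2l,k} := (−1)^k · ((2l+k−2)!/4^l) · ∑_{j=0}^{k} C(2j+2l, j+l)·C(k,j)·(−2)^{−j} and y_{2l−1,k} := (k+2l−2)!. Then x_{2l,0} = ((2l−2)!/4^l)·C(2l,l) and y_{2l−1,0} = (2l−2)!, and for all integers l ≥ 2 and k ≥ 1 the following two identities hold: (4l+3k+2)·x_{2l,k+1} + 2k·x_{2l+2,k−1} − 2·x_{2l+2,k} = 3k·(2l+k−2)(2l+k−1)·x_{2l,k−1}, and (4l+3k)·y_{2l−1,k+1} + 2k·y_{2l+1,k−1} − 2·y_{2l+1,k} = 3k·(2l+k−2)(2l+k−1)·y_{2l−1,k−1}. -/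
open Finset

/-- The closed form `x_{2l,k} = (−1)^k ((2l+k−2)!/4^l) ∑_{j=0}^k C(2j+2l,j+l)C(k,j)(−2)^{−j}`
for the rescaled even-index joint cumulants. -/
noncomputable def xEven (l k : ℕ) : ℚ :=
  (-1 : ℚ) ^ k * ((Nat.factorial (2 * l + k - 2) : ℚ) / 4 ^ l) *
    ∑ j ∈ Finset.range (k + 1),
      (Nat.choose (2 * j + 2 * l) (j + l) : ℚ) * (Nat.choose k j : ℚ) * ((-2 : ℚ)⁻¹) ^ j

/-- The closed form `y_{2l−1,k} = (k+2l−2)!` for the rescaled odd-index joint cumulants. -/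
noncomputable def yOdd (l k : ℕ) : ℚ := (Nat.factorial (k + 2 * l - 2) : ℚ)

/-- The binomial transform `∑_{j=0}^k C(2j+2l,j+l) C(k,j) (−2)^{−j}` of the shifted central
binomial coefficients. -/
def centralBinomTransform (l k : ℕ) : ℚ :=
  ∑ j ∈ Finset.range (k + 1),
    (Nat.choose (2 * j + 2 * l) (j + l) : ℚ) * (Nat.choose k j : ℚ) * ((-2 : ℚ)⁻¹) ^ j

theorem centralBinomTransform_zero (l : ℕ) :
    centralBinomTransform l 0 = (Nat.centralBinom l : ℚ) := by
  simp [centralBinomTransform, Nat.centralBinom]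

theorem centralBinomTransform_succ_left (l k : ℕ) :
    centralBinomTransform (l + 1) k =
      2 * centralBinomTransform l k - 2 * centralBinomTransform l (k + 1) := by
  have pascal : centralBinomTransform l (k + 1) =
      centralBinomTransform l k - centralBinomTransform (l + 1) k / 2 := by
    have extend : centralBinomTransform l k = ∑ j ∈ Finset.range (k + 2),
        (Nat.choose (2 * j + 2 * l) (j + l) : ℚ) * (Nat.choose k j : ℚ) * ((-2 : ℚ)⁻¹) ^ j := by
      rw [Finset.sum_range_succ, Nat.choose_succ_self]
      simp [centralBinomTransform]
    rw [extend]
    unfold centralBinomTransform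
    rw [Finset.sum_range_succ', Finset.sum_range_succ' _ (k + 1), Finset.sum_div,
      add_sub_right_comm, ← Finset.sum_sub_distrib]
    congr 1
    · refine Finset.sum_congr rfl fun j _ => ?_
      rw [Nat.choose_succ_succ' k j, show 2 * (j + 1) + 2 * l = 2 * j + 2 * (l + 1) by ring,
        show j + 1 + l = j + (l + 1) by ring, pow_succ]
      push_cast
      ring
    · simp
  linarith

theorem centralBinomTransform_one (l : ℕ) :
    ((l : ℚ) + 1) * centralBinomTransform l 1 + l * centralBinomTransform l 0 = 0 := by
  have step := centralBinomTransform_succ_left l 0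
  have central : ((l : ℚ) + 1) * Nat.centralBinom (l + 1) = 2 * (2 * l + 1) * Nat.centralBinom l :=
    mod_cast Nat.succ_mul_centralBinom_succ l
  rw [zero_add, centralBinomTransform_zero, centralBinomTransform_zero] at step
  rw [centralBinomTransform_zero]
  linear_combination ((l + 1 : ℚ) / 2) * step - central / 2

/-- The three-term recurrence of `centralBinomTransform` in its second index. -/
theorem centralBinomTransform_three_term (l k : ℕ) :
    ((l : ℚ) + k + 2) * centralBinomTransform l (k + 2) + l * centralBinomTransform l (k + 1)
      - (k + 1) * centralBinomTransform l k = 0 := by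
  induction k generalizing l with
  | zero =>
    have h₀ := centralBinomTransform_one l
    have h₁ := centralBinomTransform_one (l + 1)
    rw [centralBinomTransform_succ_left, centralBinomTransform_succ_left] at h₁
    push_cast at h₁ ⊢
    linear_combination h₀ - h₁ / 2
  | succ k ih =>
    have h₀ := ih l
    have h₁ := ih (l + 1)
    simp only [centralBinomTransform_succ_left] at h₁
    push_cast at h₁ ⊢
    linear_combination h₀ - h₁ / 2

theorem xEven_eq (l k : ℕ) :
    xEven l k = (-1 : ℚ) ^ k * ((Nat.factorial (2 * l + k - 2) : ℚ) / 4 ^ l) *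
      centralBinomTransform l k := rfl

theorem xEven_recurrence (l k : ℕ) (hl : 1 ≤ l) (hk : 1 ≤ k) :
    (4 * (l : ℚ) + 3 * k + 2) * xEven l (k + 1) + 2 * (k : ℚ) * xEven (l + 1) (k - 1)
        - 2 * xEven (l + 1) k
      = 3 * (k : ℚ) * (2 * (l : ℚ) + k - 2) * (2 * (l : ℚ) + k - 1) * xEven l (k - 1) := by
  obtain ⟨m, rfl⟩ := Nat.exists_eq_add_of_le' hl
  obtain ⟨n, rfl⟩ := Nat.exists_eq_add_of_le' hk
  have h := centralBinomTransform_three_term (m + 1) n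
  simp only [xEven_eq, Nat.add_sub_cancel, centralBinomTransform_succ_left (m + 1)]
  rw [show 2 * (m + 1) + (n + 1 + 1) - 2 = 2 * m + n + 1 + 1 by lia,
    show 2 * (m + 1 + 1) + n - 2 = 2 * m + n + 1 + 1 by lia,
    show 2 * (m + 1 + 1) + (n + 1) - 2 = 2 * m + n + 1 + 1 + 1 by lia,
    show 2 * (m + 1) + n - 2 = 2 * m + n by lia]
  simp only [Nat.factorial_succ, pow_succ]
  push_cast at h ⊢
  linear_combination
    (2 * (-1 : ℚ) ^ n * (2 * m + n + 2) * (2 * m + n + 1) * (2 * m + n).factorial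
      / (4 ^ m * 4)) * h

theorem yOdd_recurrence (l k : ℕ) (hl : 1 ≤ l) (hk : 1 ≤ k) :
    (4 * (l : ℚ) + 3 * k) * yOdd l (k + 1) + 2 * (k : ℚ) * yOdd (l + 1) (k - 1)
        - 2 * yOdd (l + 1) k
      = 3 * (k : ℚ) * (2 * (l : ℚ) + k - 2) * (2 * (l : ℚ) + k - 1) * yOdd l (k - 1) := by
  obtain ⟨m, rfl⟩ := Nat.exists_eq_add_of_le' hl
  obtain ⟨n, rfl⟩ := Nat.exists_eq_add_of_le' hk
  simp only [yOdd, Nat.add_sub_cancel]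
  rw [show n + 1 + 1 + 2 * (m + 1) - 2 = 2 * m + n + 1 + 1 by lia,
    show n + 2 * (m + 1 + 1) - 2 = 2 * m + n + 1 + 1 by lia,
    show n + 1 + 2 * (m + 1 + 1) - 2 = 2 * m + n + 1 + 1 + 1 by lia,
    show n + 2 * (m + 1) - 2 = 2 * m + n by lia]
  simp only [Nat.factorial_succ]
  push_cast
  ring

/-- The closed forms `x_{2l,k}` and `y_{2l−1,k}` satisfy the required initial conditions and
the limiting recurrence relation for the rescaled joint cumulants of conductance and
shot noise. -/
theorem rescaled_joint_cumulants_closed_form :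
    (∀ l : ℕ, 2 ≤ l →
      xEven l 0 = ((Nat.factorial (2 * l - 2) : ℚ) / 4 ^ l) * (Nat.choose (2 * l) l : ℚ) ∧
      yOdd l 0 = (Nat.factorial (2 * l - 2) : ℚ)) ∧
    (∀ l k : ℕ, 2 ≤ l → 1 ≤ k →
      (4 * (l : ℚ) + 3 * k + 2) * xEven l (k + 1) + 2 * (k : ℚ) * xEven (l + 1) (k - 1)
          - 2 * xEven (l + 1) k
        = 3 * (k : ℚ) * (2 * (l : ℚ) + k - 2) * (2 * (l : ℚ) + k - 1) * xEven l (k - 1) ∧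
      (4 * (l : ℚ) + 3 * k) * yOdd l (k + 1) + 2 * (k : ℚ) * yOdd (l + 1) (k - 1)
          - 2 * yOdd (l + 1) k
        = 3 * (k : ℚ) * (2 * (l : ℚ) + k - 2) * (2 * (l : ℚ) + k - 1) * yOdd l (k - 1)) := by
  refine ⟨fun l _ => ⟨?_, ?_⟩, fun l k hl hk =>
    ⟨xEven_recurrence l k (by lia) hk, yOdd_recurrence l k (by lia) hk⟩⟩
  · simp [xEven]
  · simp [yOdd]
end
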